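/- arXiv:1407.3978 — 2 statements merged into one kernel-verified Lean document; each statement's English description precedes it below -/
import Mathlib

section
/- Let T be a finite-dimensional Leibniz triple system over a field K of characteristic 0, with solvable radical R(T) and Ker(T) the span of all {abc} − {acb} + {bca}. Then: (1) T/R(T) is a semisimple Lie triple system (its only solvable ideal is zero); (2) if I is an ideal of T such that T/I is a semisimple Leibniz triple system, then R(T) ⊆ Ker(T) + I; (3) if I is an ideal of T such that T/I is a semisimple Lie triple system, then R(T) ⊆ I. -/
open TensorProduct

noncomputable section

variable {K : Type*} [Field K] [CharZero K]
variable {T : Type*} [AddCommGroup T] [Module K T]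

/-- First defining identity of a Leibniz triple system:
`{a{bcd}e} = {{abc}de} − {{acb}de} − {{adb}ce} + {{adc}be}`. -/
def LTS1 (t : T →ₗ[K] T →ₗ[K] T →ₗ[K] T) : Prop :=
  ∀ a b c d e : T,
    t a (t b c d) e =
      t (t a b c) d e - t (t a c b) d e - t (t a d b) c e + t (t a d c) b e

/-- Second defining identity of a Leibniz triple system:
`{ab{cde}} = {{abc}de} − {{abd}ce} − {{abe}cd} + {{abe}dc}`. -/
def LTS2 (t : T →ₗ[K] T →ₗ[K] T →ₗ[K] T) : Prop :=
  ∀ a b c d e : T,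
    t a b (t c d e) =
      t (t a b c) d e - t (t a b d) c e - t (t a b e) c d + t (t a b e) d c

/-- The axioms of a Lie triple system. -/
def IsLieTS (t : T →ₗ[K] T →ₗ[K] T →ₗ[K] T) : Prop :=
  (∀ a c : T, t a a c = 0) ∧
  (∀ a b c : T, t a b c + t b c a + t c a b = 0) ∧
  (∀ a b c d e : T,
    t a b (t c d e) = t (t a b c) d e + t c (t a b d) e + t c d (t a b e))

/-- The bracket of the universal Leibniz envelope `U(T) = T ⊕ (T ⊗ T)`,
determined by `[a,b] = a⊗b`, `[a⊗b,c] = {abc}`, `[a,b⊗c] = {abc} − {acb}`,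
`[a⊗b,c⊗d] = {abc}⊗d − {abd}⊗c`. -/
def bkt (t : T →ₗ[K] T →ₗ[K] T →ₗ[K] T) (x y : T × (T ⊗[K] T)) :
    T × (T ⊗[K] T) :=
  (TensorProduct.lift t x.2 y.1
      + TensorProduct.lift (t x.1) y.2 - TensorProduct.lift ((t x.1).flip) y.2,
   x.1 ⊗ₜ[K] y.1
      + LinearMap.rTensor T (TensorProduct.lift t x.2) y.2
      - LinearMap.rTensor T (TensorProduct.lift t x.2) (TensorProduct.comm K T T y.2))

/-- The induced bracket on the subalgebra `T ⊗ T` of `U(T)`. -/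
def bktT (t : T →ₗ[K] T →ₗ[K] T →ₗ[K] T) (w w' : T ⊗[K] T) : T ⊗[K] T :=
  LinearMap.rTensor T (TensorProduct.lift t w) w'
    - LinearMap.rTensor T (TensorProduct.lift t w) (TensorProduct.comm K T T w')

/-- `{ABC}`: the span of all products `{abc}` with `a ∈ A`, `b ∈ B`, `c ∈ C`. -/
def tspan (t : T →ₗ[K] T →ₗ[K] T →ₗ[K] T) (A B C : Submodule K T) : Submodule K T :=
  Submodule.span K {x | ∃ a ∈ A, ∃ b ∈ B, ∃ c ∈ C, x = t a b c}

/-- `I` is an ideal of the Leibniz triple system `(T, t)`. -/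
def IsIdealT (t : T →ₗ[K] T →ₗ[K] T →ₗ[K] T) (I : Submodule K T) : Prop :=
  ∀ x ∈ I, ∀ a b : T, t x a b ∈ I ∧ t a x b ∈ I ∧ t a b x ∈ I

/-- `i(I) = I ⊗ T + T ⊗ I` as a subspace of `T ⊗ T`. -/
def iI (I : Submodule K T) : Submodule K (T ⊗[K] T) :=
  Submodule.span K
    {z | (∃ x ∈ I, ∃ a : T, z = x ⊗ₜ[K] a) ∨ (∃ x ∈ I, ∃ a : T, z = a ⊗ₜ[K] x)}

/-- `j(I) = {w ∈ T⊗T | [w, T] + [T, w] ⊆ I}`. -/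
def jI (t : T →ₗ[K] T →ₗ[K] T →ₗ[K] T) (I : Submodule K T) : Submodule K (T ⊗[K] T) :=
  ⨅ a : T,
    Submodule.comap ((TensorProduct.lift t).flip a) I ⊓
      Submodule.comap (TensorProduct.lift (t a) - TensorProduct.lift ((t a).flip)) I

/-- `𝕀(I) = I + i(I)` as a subspace of `U(T)`. -/
def IU (I : Submodule K T) : Submodule K (T × (T ⊗[K] T)) := I.prod (iI I)

/-- `𝕁(I) = I + j(I)` as a subspace of `U(T)`. -/
def JU (t : T →ₗ[K] T →ₗ[K] T →ₗ[K] T) (I : Submodule K T) :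
    Submodule K (T × (T ⊗[K] T)) := I.prod (jI t I)

/-- `V` is an ideal of the Leibniz algebra `T ⊗ T`. -/
def IsIdealTT (t : T →ₗ[K] T →ₗ[K] T →ₗ[K] T) (V : Submodule K (T ⊗[K] T)) : Prop :=
  ∀ v ∈ V, ∀ w : T ⊗[K] T, bktT t v w ∈ V ∧ bktT t w v ∈ V

/-- `V` is an ideal of the Leibniz algebra `U(T)`. -/
def IsIdealU (t : T →ₗ[K] T →ₗ[K] T →ₗ[K] T) (V : Submodule K (T × (T ⊗[K] T))) : Prop :=
  ∀ v ∈ V, ∀ x : T × (T ⊗[K] T), bkt t v x ∈ V ∧ bkt t x v ∈ V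

/-- The derived series of `I` relative to an ambient subsystem `S`:
`I⁰ = I`, `Iⁿ⁺¹ = {S Iⁿ Iⁿ} + {Iⁿ S Iⁿ} + {Iⁿ Iⁿ S}`. -/
def derRel (t : T →ₗ[K] T →ₗ[K] T →ₗ[K] T) (S I : Submodule K T) : ℕ → Submodule K T
  | 0 => I
  | n + 1 =>
      tspan t S (derRel t S I n) (derRel t S I n) ⊔
        tspan t (derRel t S I n) S (derRel t S I n) ⊔
          tspan t (derRel t S I n) (derRel t S I n) S

/-- The derived series `I^[n]` of an ideal `I` of `T`:
`I^[0] = I`, `I^[n+1] = {T I^[n] I^[n]} + {I^[n] T I^[n]} + {I^[n] I^[n] T}`. -/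
def derT (t : T →ₗ[K] T →ₗ[K] T →ₗ[K] T) (I : Submodule K T) : ℕ → Submodule K T :=
  derRel t ⊤ I

/-- `I` is a solvable ideal of the Leibniz triple system `T`. -/
def IsSolvT (t : T →ₗ[K] T →ₗ[K] T →ₗ[K] T) (I : Submodule K T) : Prop :=
  ∃ k, derT t I k = ⊥

/-- The span of all brackets `[x, y]`, `x ∈ A`, `y ∈ B`, in `U(T)`. -/
def bspan (t : T →ₗ[K] T →ₗ[K] T →ₗ[K] T) (A B : Submodule K (T × (T ⊗[K] T))) :
    Submodule K (T × (T ⊗[K] T)) :=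
  Submodule.span K {z | ∃ x ∈ A, ∃ y ∈ B, z = bkt t x y}

/-- The derived series of a subspace `V` of the Leibniz algebra `U(T)`. -/
def derU (t : T →ₗ[K] T →ₗ[K] T →ₗ[K] T) (V : Submodule K (T × (T ⊗[K] T))) :
    ℕ → Submodule K (T × (T ⊗[K] T))
  | 0 => V
  | n + 1 => bspan t (derU t V n) (derU t V n)

/-- `V` is a solvable subspace of the Leibniz algebra `U(T)`. -/
def IsSolvU (t : T →ₗ[K] T →ₗ[K] T →ₗ[K] T) (V : Submodule K (T × (T ⊗[K] T))) : Prop :=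
  ∃ k, derU t V k = ⊥

/-- The solvable radical `R(T)`: the sum of all solvable ideals of `T`. -/
def radT (t : T →ₗ[K] T →ₗ[K] T →ₗ[K] T) : Submodule K T :=
  sSup {S : Submodule K T | IsIdealT t S ∧ IsSolvT t S}

/-- The solvable radical `Rad(U(T))`: the sum of all solvable ideals of `U(T)`. -/
def radU (t : T →ₗ[K] T →ₗ[K] T →ₗ[K] T) : Submodule K (T × (T ⊗[K] T)) :=
  sSup {V : Submodule K (T × (T ⊗[K] T)) | IsIdealU t V ∧ IsSolvU t V}

/-- `Ker(T)`: the span of all `{abc} − {acb} + {bca}`. -/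
def kerT (t : T →ₗ[K] T →ₗ[K] T →ₗ[K] T) : Submodule K T :=
  Submodule.span K {x | ∃ a b c : T, x = t a b c - t a c b + t b c a}

/-- `Ker(U(T))`: the span of all `[x, x]`, `x ∈ U(T)`. -/
def kerU (t : T →ₗ[K] T →ₗ[K] T →ₗ[K] T) : Submodule K (T × (T ⊗[K] T)) :=
  Submodule.span K {z | ∃ x : T × (T ⊗[K] T), z = bkt t x x}

/-- The central lower sequence of an ideal `I` of `T`: `I⁰ = I`,
`Iᵐ⁺¹ = {Iᵐ I T} + {Iᵐ T I} + {I Iᵐ T} + {I T Iᵐ} + {T I Iᵐ} + {T Iᵐ I}`. -/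
def clsT (t : T →ₗ[K] T →ₗ[K] T →ₗ[K] T) (I : Submodule K T) : ℕ → Submodule K T
  | 0 => I
  | m + 1 =>
      tspan t (clsT t I m) I ⊤ ⊔ tspan t (clsT t I m) ⊤ I ⊔
        tspan t I (clsT t I m) ⊤ ⊔ tspan t I ⊤ (clsT t I m) ⊔
          tspan t ⊤ I (clsT t I m) ⊔ tspan t ⊤ (clsT t I m) I

/-- `I` is a nilpotent ideal of the Leibniz triple system `T`. -/
def IsNilT (t : T →ₗ[K] T →ₗ[K] T →ₗ[K] T) (I : Submodule K T) : Prop :=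
  ∃ n, clsT t I n = ⊥

/-- The lower central series of a subspace `V` of the Leibniz algebra `U(T)`:
`V⁰ = V`, `Vᵐ⁺¹ = [Vᵐ, V]`. -/
def clsU (t : T →ₗ[K] T →ₗ[K] T →ₗ[K] T) (V : Submodule K (T × (T ⊗[K] T))) :
    ℕ → Submodule K (T × (T ⊗[K] T))
  | 0 => V
  | m + 1 => bspan t (clsU t V m) V

/-- `V` is a nilpotent subspace of the Leibniz algebra `U(T)`. -/
def IsNilU (t : T →ₗ[K] T →ₗ[K] T →ₗ[K] T) (V : Submodule K (T × (T ⊗[K] T))) : Prop :=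
  ∃ n, clsU t V n = ⊥

/-- `Tⁿ`: the lower central series of `T`, `T⁰ = T`,
`Tⁿ⁺¹ = {Tⁿ T T} + {T Tⁿ T} + {T T Tⁿ}`. -/
def lcsT (t : T →ₗ[K] T →ₗ[K] T →ₗ[K] T) : ℕ → Submodule K T
  | 0 => ⊤
  | n + 1 => tspan t (lcsT t n) ⊤ ⊤ ⊔ tspan t ⊤ (lcsT t n) ⊤ ⊔ tspan t ⊤ ⊤ (lcsT t n)

/-- `T⁽ⁿ⁾`: `T⁽⁰⁾ = T`, `T⁽ⁿ⁺¹⁾ = {T⁽ⁿ⁾ T T}`. -/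
def powT (t : T →ₗ[K] T →ₗ[K] T →ₗ[K] T) : ℕ → Submodule K T
  | 0 => ⊤
  | n + 1 => tspan t (powT t n) ⊤ ⊤


section LeibnizTripleSystem

set_option linter.unusedSectionVars false

variable {t : T →ₗ[K] T →ₗ[K] T →ₗ[K] T}
variable {Q : Type*} [AddCommGroup Q] [Module K Q] {t' : Q →ₗ[K] Q →ₗ[K] Q →ₗ[K] Q}
variable {π : T →ₗ[K] Q}

theorem derT_succ_le {I D : Submodule K T} {n : ℕ}
    (h : ∀ x ∈ derT t I n, ∀ y ∈ derT t I n, ∀ a : T,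
      t a x y ∈ D ∧ t x a y ∈ D ∧ t x y a ∈ D) :
    derT t I (n + 1) ≤ D := by
  refine sup_le (sup_le ?_ ?_) ?_ <;> refine Submodule.span_le.2 ?_
  · rintro _ ⟨a, -, x, hx, y, hy, rfl⟩
    exact (h x hx y hy a).1
  · rintro _ ⟨x, hx, a, -, y, hy, rfl⟩
    exact (h x hx y hy a).2.1
  · rintro _ ⟨x, hx, y, hy, a, -, rfl⟩
    exact (h x hx y hy a).2.2

theorem mem_derT_succ {I : Submodule K T} {n : ℕ} {x y : T}
    (hx : x ∈ derT t I n) (hy : y ∈ derT t I n) (a : T) :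
    t a x y ∈ derT t I (n + 1) ∧ t x a y ∈ derT t I (n + 1) ∧ t x y a ∈ derT t I (n + 1) :=
  ⟨Submodule.mem_sup_left (Submodule.mem_sup_left
      (Submodule.subset_span ⟨a, trivial, x, hx, y, hy, rfl⟩)),
    Submodule.mem_sup_left (Submodule.mem_sup_right
      (Submodule.subset_span ⟨x, hx, a, trivial, y, hy, rfl⟩)),
    Submodule.mem_sup_right (Submodule.subset_span ⟨x, hx, y, hy, a, trivial, rfl⟩)⟩

/-- If the `k`-th derived term of `I` lies in `J`, later terms lie in the derived series of `J`. -/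
theorem derT_add_le {I J : Submodule K T} {k : ℕ} (h : derT t I k ≤ J) (m : ℕ) :
    derT t I (k + m) ≤ derT t J m := by
  induction m with
  | zero => exact h
  | succ m ih => exact derT_succ_le fun x hx y hy ↦ mem_derT_succ (ih hx) (ih hy)

theorem IsSolvT.of_derT_le {I J : Submodule K T} {k : ℕ} (hJ : IsSolvT t J)
    (h : derT t I k ≤ J) : IsSolvT t I := by
  obtain ⟨m, hm⟩ := hJ
  exact ⟨k + m, eq_bot_iff.2 ((derT_add_le h m).trans hm.le)⟩

theorem derT_sup_le {I J : Submodule K T} (hJ : IsIdealT t J) (n : ℕ) :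
    derT t (I ⊔ J) n ≤ derT t I n ⊔ J := by
  induction n with
  | zero => exact le_rfl
  | succ n ih =>
    refine derT_succ_le fun x' hx' y' hy' a ↦ ?_
    obtain ⟨x, hx, u, hu, rfl⟩ := Submodule.mem_sup.1 (ih hx')
    obtain ⟨y, hy, v, hv, rfl⟩ := Submodule.mem_sup.1 (ih hy')
    obtain ⟨p₁, p₂, p₃⟩ := mem_derT_succ hx hy a
    have split {p q : T} (hp : p ∈ derT t I (n + 1)) (hq : q - p ∈ J) :
        q ∈ derT t I (n + 1) ⊔ J := by
      simpa using Submodule.add_mem_sup hp hq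
    have e₁ : t a (x + u) (y + v) - t a x y = t a u y + t a (x + u) v := by
      simp only [map_add, LinearMap.add_apply]
      abel
    have e₂ : t (x + u) a (y + v) - t x a y = t u a y + t (x + u) a v := by
      simp only [map_add, LinearMap.add_apply]
      abel
    have e₃ : t (x + u) (y + v) a - t x y a = t u y a + t (x + u) v a := by
      simp only [map_add, LinearMap.add_apply]
      abel
    exact ⟨split p₁ (e₁ ▸ add_mem (hJ u hu a y).2.1 (hJ v hv a (x + u)).2.2),
      split p₂ (e₂ ▸ add_mem (hJ u hu a y).1 (hJ v hv (x + u) a).2.2),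
      split p₃ (e₃ ▸ add_mem (hJ u hu y a).1 (hJ v hv (x + u) a).2.1)⟩

theorem IsIdealT.sup {I J : Submodule K T} (hI : IsIdealT t I) (hJ : IsIdealT t J) :
    IsIdealT t (I ⊔ J) := by
  intro x hx a b
  obtain ⟨u, hu, v, hv, rfl⟩ := Submodule.mem_sup.1 hx
  simp only [map_add, LinearMap.add_apply]
  exact ⟨Submodule.add_mem_sup (hI u hu a b).1 (hJ v hv a b).1,
    Submodule.add_mem_sup (hI u hu a b).2.1 (hJ v hv a b).2.1,
    Submodule.add_mem_sup (hI u hu a b).2.2 (hJ v hv a b).2.2⟩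

theorem IsSolvT.sup {I J : Submodule K T} (hI : IsSolvT t I) (hJ : IsIdealT t J)
    (hJ' : IsSolvT t J) : IsSolvT t (I ⊔ J) := by
  obtain ⟨k, hk⟩ := hI
  have h := derT_sup_le (I := I) hJ k
  rw [hk, bot_sup_eq] at h
  exact hJ'.of_derT_le h

/-- In finite dimension the radical is itself a solvable ideal. -/
theorem radT_mem [FiniteDimensional K T] (t : T →ₗ[K] T →ₗ[K] T →ₗ[K] T) :
    IsIdealT t (radT t) ∧ IsSolvT t (radT t) := by
  refine CompleteLattice.WellFoundedGT.isSupClosedCompact (Submodule K T) inferInstance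
    {S : Submodule K T | IsIdealT t S ∧ IsSolvT t S} ⟨⊥, ?_, 0, rfl⟩
    fun I hI J hJ ↦ ⟨hI.1.sup hJ.1, hI.2.sup hJ.1 hJ.2⟩
  rintro x hx a b
  rw [(Submodule.mem_bot K).1 hx]
  simp

theorem IsIdealT.comap (hhom : ∀ a b c : T, π (t a b c) = t' (π a) (π b) (π c))
    {S : Submodule K Q} (hS : IsIdealT t' S) : IsIdealT t (S.comap π) := by
  intro x hx a b
  simp only [Submodule.mem_comap, hhom]
  exact hS _ hx _ _

theorem derT_comap_le (hhom : ∀ a b c : T, π (t a b c) = t' (π a) (π b) (π c))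
    (S : Submodule K Q) (n : ℕ) : derT t (S.comap π) n ≤ (derT t' S n).comap π := by
  induction n with
  | zero => exact le_rfl
  | succ n ih =>
    refine derT_succ_le fun x hx y hy a ↦ ?_
    simp only [Submodule.mem_comap, hhom]
    exact mem_derT_succ (ih hx) (ih hy) _

theorem IsSolvT.comap (hhom : ∀ a b c : T, π (t a b c) = t' (π a) (π b) (π c))
    {S : Submodule K Q} (hS : IsSolvT t' S) (hker : IsSolvT t (LinearMap.ker π)) :
    IsSolvT t (S.comap π) := by
  obtain ⟨k, hk⟩ := hS
  have h := derT_comap_le hhom S k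
  rw [hk, Submodule.comap_bot] at h
  exact hker.of_derT_le h

theorem IsIdealT.map (hπ : Function.Surjective π)
    (hhom : ∀ a b c : T, π (t a b c) = t' (π a) (π b) (π c))
    {I : Submodule K T} (hI : IsIdealT t I) : IsIdealT t' (I.map π) := by
  rintro _ ⟨x, hx, rfl⟩ a b
  obtain ⟨a, rfl⟩ := hπ a
  obtain ⟨b, rfl⟩ := hπ b
  simp only [← hhom]
  obtain ⟨h₁, h₂, h₃⟩ := hI x hx a b
  exact ⟨Submodule.mem_map_of_mem h₁, Submodule.mem_map_of_mem h₂, Submodule.mem_map_of_mem h₃⟩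

theorem derT_map_le (hπ : Function.Surjective π)
    (hhom : ∀ a b c : T, π (t a b c) = t' (π a) (π b) (π c))
    (I : Submodule K T) (n : ℕ) : derT t' (I.map π) n ≤ (derT t I n).map π := by
  induction n with
  | zero => exact le_rfl
  | succ n ih =>
    refine derT_succ_le fun x' hx' y' hy' a ↦ ?_
    obtain ⟨x, hx, rfl⟩ := ih hx'
    obtain ⟨y, hy, rfl⟩ := ih hy'
    obtain ⟨a, rfl⟩ := hπ a
    simp only [← hhom]
    obtain ⟨h₁, h₂, h₃⟩ := mem_derT_succ hx hy a
    exact ⟨Submodule.mem_map_of_mem h₁, Submodule.mem_map_of_mem h₂, Submodule.mem_map_of_mem h₃⟩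

theorem IsSolvT.map (hπ : Function.Surjective π)
    (hhom : ∀ a b c : T, π (t a b c) = t' (π a) (π b) (π c))
    {I : Submodule K T} (hI : IsSolvT t I) : IsSolvT t' (I.map π) := by
  obtain ⟨k, hk⟩ := hI
  refine ⟨k, eq_bot_iff.2 ((derT_map_le hπ hhom I k).trans ?_)⟩
  rw [hk, Submodule.map_bot]

theorem map_radT_le_radT [FiniteDimensional K T] (hπ : Function.Surjective π)
    (hhom : ∀ a b c : T, π (t a b c) = t' (π a) (π b) (π c)) :
    (radT t).map π ≤ radT t' :=
  le_sSup ⟨(radT_mem t).1.map hπ hhom, (radT_mem t).2.map hπ hhom⟩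

theorem map_kerT (hπ : Function.Surjective π)
    (hhom : ∀ a b c : T, π (t a b c) = t' (π a) (π b) (π c)) :
    (kerT t).map π = kerT t' := by
  rw [kerT, kerT, Submodule.map_span]
  congr 1
  ext q
  constructor
  · rintro ⟨_, ⟨a, b, c, rfl⟩, rfl⟩
    exact ⟨π a, π b, π c, by simp only [map_add, map_sub, hhom]⟩
  · rintro ⟨a, b, c, rfl⟩
    obtain ⟨a, rfl⟩ := hπ a
    obtain ⟨b, rfl⟩ := hπ b
    obtain ⟨c, rfl⟩ := hπ c
    exact ⟨_, ⟨a, b, c, rfl⟩, by simp only [map_add, map_sub, hhom]⟩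

theorem apply_mem_kerT_right (h2 : LTS2 t) {x : T} (hx : x ∈ kerT t) (a b : T) :
    t a b x = 0 := by
  have h : kerT t ≤ LinearMap.ker (t a b) := by
    refine Submodule.span_le.2 ?_
    rintro _ ⟨c, d, e, rfl⟩
    simp only [SetLike.mem_coe, LinearMap.mem_ker, map_add, map_sub]
    rw [h2 a b c d e, h2 a b c e d, h2 a b d e c]
    abel
  exact h hx

theorem apply_mem_kerT_middle (h1 : LTS1 t) {x : T} (hx : x ∈ kerT t) (a b : T) :
    t a x b = 0 := by
  have h : kerT t ≤ LinearMap.ker ((t a).flip b) := by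
    refine Submodule.span_le.2 ?_
    rintro _ ⟨c, d, e, rfl⟩
    simp only [SetLike.mem_coe, LinearMap.mem_ker, map_add, map_sub, LinearMap.flip_apply]
    rw [h1 a c d e b, h1 a c e d b, h1 a d e c b]
    abel
  exact h hx

theorem apply_mem_kerT_left (h1 : LTS1 t) (h2 : LTS2 t) {x : T} (hx : x ∈ kerT t) (d e : T) :
    t x d e ∈ kerT t := by
  have gen (a b c : T) : t a b c - t a c b + t b c a ∈ kerT t :=
    Submodule.subset_span ⟨a, b, c, rfl⟩
  have h : kerT t ≤ (kerT t).comap (t.flip d |>.flip e) := by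
    refine Submodule.span_le.2 ?_
    rintro _ ⟨a, b, c, rfl⟩
    have key : t (t a b c - t a c b + t b c a) d e =
        (t (t a d e) b c - t (t a d e) c b + t b c (t a d e)) +
        (t (t b c e) a d - t (t b c e) d a + t a d (t b c e)) +
        (t (t b c d) a e - t (t b c d) e a + t a e (t b c d)) +
        (t a (t b c d) e - t a e (t b c d) + t (t b c d) e a) := by
      simp only [map_add, map_sub, LinearMap.add_apply, LinearMap.sub_apply]
      rw [h2 b c a d e, h2 a d b c e, h1 a b c d e]
      abel
    simp only [SetLike.mem_coe, Submodule.mem_comap, LinearMap.flip_apply]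
    rw [key]
    exact add_mem (add_mem (add_mem (gen _ _ _) (gen _ _ _)) (gen _ _ _)) (gen _ _ _)
  exact h hx

theorem kerT_le_radT (h1 : LTS1 t) (h2 : LTS2 t) : kerT t ≤ radT t := by
  refine le_sSup ⟨fun x hx a b ↦ ⟨apply_mem_kerT_left h1 h2 hx a b, ?_, ?_⟩, 1, ?_⟩
  · rw [apply_mem_kerT_middle h1 hx]
    exact zero_mem _
  · rw [apply_mem_kerT_right h2 hx]
    exact zero_mem _
  · refine eq_bot_iff.2 (derT_succ_le fun x hx y hy a ↦ ?_)
    simp only [Submodule.mem_bot]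
    exact ⟨apply_mem_kerT_right h2 hy a x, apply_mem_kerT_right h2 hy x a,
      apply_mem_kerT_middle h1 hy x a⟩

/-- A quotient of a Leibniz triple system by an ideal containing `Ker(T)` is a Lie triple
system. -/
theorem isLieTS_of_kerT_le_ker (h2 : LTS2 t) (hπ : Function.Surjective π)
    (hhom : ∀ a b c : T, π (t a b c) = t' (π a) (π b) (π c))
    (hker : kerT t ≤ LinearMap.ker π) : IsLieTS t' := by
  have hgen (a b c : Q) : t' a b c - t' a c b + t' b c a = 0 := by
    obtain ⟨a, rfl⟩ := hπ a
    obtain ⟨b, rfl⟩ := hπ b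
    obtain ⟨c, rfl⟩ := hπ c
    simpa only [map_add, map_sub, hhom] using
      LinearMap.mem_ker.1 (hker (Submodule.subset_span ⟨a, b, c, rfl⟩))
  have halt (a c : Q) : t' a a c = 0 := by simpa using hgen c a a
  have hanti (a b c : Q) : t' a b c = -t' b a c := by
    have h := halt (a + b) c
    simp only [map_add, LinearMap.add_apply, halt, zero_add, add_zero] at h
    exact eq_neg_of_add_eq_zero_right h
  refine ⟨halt, fun a b c ↦ ?_, fun a b c d e ↦ ?_⟩
  · rw [← hgen a b c, hanti c a b]
    abel
  · have h : t' a b (t' c d e) = t' (t' a b c) d e - t' (t' a b d) c e - t' (t' a b e) c d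
        + t' (t' a b e) d c := by
      obtain ⟨a, rfl⟩ := hπ a
      obtain ⟨b, rfl⟩ := hπ b
      obtain ⟨c, rfl⟩ := hπ c
      obtain ⟨d, rfl⟩ := hπ d
      obtain ⟨e, rfl⟩ := hπ e
      simpa only [map_add, map_sub, hhom] using congrArg π (h2 a b c d e)
    rw [h, hanti c (t' a b d) e, ← sub_eq_zero, ← hgen (t' a b e) d c,
      hanti d c (t' a b e)]
    abel

end LeibnizTripleSystem

universe u

/-- (1) `T/R(T)` is a semisimple Lie triple system; (2) if `T/I` is a semisimple
Leibniz triple system then `R(T) ⊆ Ker(T) + I`; (3) if `T/I` is a semisimple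
Lie triple system then `R(T) ⊆ I`.  Quotients are encoded via surjective
homomorphisms `π` with the prescribed kernel. -/
theorem semisimple_quotients
    [FiniteDimensional K T]
    (t : T →ₗ[K] T →ₗ[K] T →ₗ[K] T) (h1 : LTS1 t) (h2 : LTS2 t) :
    (∀ (Q : Type u) [AddCommGroup Q] [Module K Q]
        (t' : Q →ₗ[K] Q →ₗ[K] Q →ₗ[K] Q) (π : T →ₗ[K] Q),
        Function.Surjective π →
        (∀ a b c : T, π (t a b c) = t' (π a) (π b) (π c)) →
        LinearMap.ker π = radT t →
        IsLieTS t' ∧ (∀ S : Submodule K Q, IsIdealT t' S → IsSolvT t' S → S = ⊥)) ∧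
    (∀ (I : Submodule K T), IsIdealT t I →
      ∀ (Q : Type u) [AddCommGroup Q] [Module K Q]
        (t' : Q →ₗ[K] Q →ₗ[K] Q →ₗ[K] Q) (π : T →ₗ[K] Q),
        Function.Surjective π →
        (∀ a b c : T, π (t a b c) = t' (π a) (π b) (π c)) →
        LinearMap.ker π = I →
        LTS1 t' → LTS2 t' → radT t' = kerT t' →
        radT t ≤ kerT t ⊔ I) ∧
    (∀ (I : Submodule K T), IsIdealT t I →
      ∀ (Q : Type u) [AddCommGroup Q] [Module K Q]
        (t' : Q →ₗ[K] Q →ₗ[K] Q →ₗ[K] Q) (π : T →ₗ[K] Q),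
        Function.Surjective π →
        (∀ a b c : T, π (t a b c) = t' (π a) (π b) (π c)) →
        LinearMap.ker π = I →
        IsLieTS t' → (∀ S : Submodule K Q, IsIdealT t' S → IsSolvT t' S → S = ⊥) →
        radT t ≤ I) := by
  refine ⟨?_, ?_, ?_⟩
  · intro Q _ _ t' π hπ hhom hker
    refine ⟨isLieTS_of_kerT_le_ker h2 hπ hhom (hker ▸ kerT_le_radT h1 h2), fun S hS hsolv ↦ ?_⟩
    have hle : S.comap π ≤ LinearMap.ker π := by
      rw [hker]
      exact le_sSup ⟨hS.comap hhom, hsolv.comap hhom (hker ▸ (radT_mem t).2)⟩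
    rw [← Submodule.map_comap_eq_of_surjective hπ S, eq_bot_iff, Submodule.map_le_iff_le_comap]
    exact hle
  · intro I _ Q _ _ t' π hπ hhom hker _ _ hss
    have hle := map_radT_le_radT hπ hhom
    rw [hss, ← map_kerT hπ hhom, Submodule.map_le_iff_le_comap, Submodule.comap_map_eq, hker] at hle
    exact hle
  · intro I _ Q _ _ t' π hπ hhom hker _ hss
    have hbot := hss _ ((radT_mem t).1.map hπ hhom) ((radT_mem t).2.map hπ hhom)
    rw [← hker, ← Submodule.comap_bot, ← Submodule.map_le_iff_le_comap, hbot]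

end
end

section
/- Levi's theorem for Leibniz triple systems: let T be a finite-dimensional Leibniz triple system over a field K of characteristic 0 and R(T) its solvable radical. Then there is a subsystem S of T such that T = S ⊕ R(T) as vector spaces, and S (with the restricted ternary product) is a semisimple Lie triple system. -/
open TensorProduct

noncomputable section

variable {K : Type*} [Field K] [CharZero K]
variable {T : Type*} [AddCommGroup T] [Module K T]

section Cohomology

open LieAlgebra LieModule

universe u v

set_option linter.unusedSectionVars false

variable {Q : Type u} [LieRing Q] [LieAlgebra K Q] [FiniteDimensional K Q] [IsKilling K Q]

lemma eq_zero_of_killingForm_eq_zero {z : Q} (h : ∀ y, killingForm K Q z y = 0) : z = 0 := by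
  have : z ∈ LinearMap.ker (killingForm K Q) := by
    rw [LinearMap.mem_ker]; ext y; simpa using h y
  simpa using this

lemma exists_killingForm_eq (ψ : Q →ₗ[K] K) : ∃ z : Q, ∀ y, killingForm K Q z y = ψ y :=
  ⟨_, fun y => LinearMap.BilinForm.apply_toDual_symm_apply
    (hB := IsKilling.killingForm_nondegenerate K Q) ψ y⟩

lemma span_lie_eq_top : Submodule.span K {z : Q | ∃ x y : Q, z = ⁅x, y⁆} = ⊤ := by
  by_contra hne
  obtain ⟨ψ, hψ, hle⟩ := Submodule.exists_le_ker_of_lt_top _ (lt_top_iff_ne_top.2 hne)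
  apply hψ
  obtain ⟨z, hz⟩ := exists_killingForm_eq (K := K) ψ
  have hz0 : z ∈ LieAlgebra.center K Q := by
    rw [LieModule.mem_maxTrivSubmodule]
    intro x
    apply eq_zero_of_killingForm_eq_zero (K := K)
    intro y
    rw [← lie_skew, map_neg, LinearMap.neg_apply, LieModule.traceForm_apply_lie_apply, hz]
    have := hle (Submodule.subset_span ⟨x, y, rfl⟩)
    simpa using this
  rw [LieAlgebra.center_eq_bot, LieSubmodule.mem_bot] at hz0
  ext y
  simp [← hz, hz0]

lemma linearMap_eq_zero_of_lie {M : Type*} [AddCommGroup M] [Module K M] (ψ : Q →ₗ[K] M)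
    (h : ∀ x y : Q, ψ ⁅x, y⁆ = 0) : ψ = 0 := by
  rw [← LinearMap.ker_eq_top, eq_top_iff, ← span_lie_eq_top (K := K) (Q := Q), Submodule.span_le]
  rintro _ ⟨x, y, rfl⟩
  exact h x y

variable {V : Type v} [AddCommGroup V] [Module K V] [LieRingModule Q V] [LieModule K Q V]

lemma lie_eq_zero_of_lowerCentralSeries_eq_bot {k : ℕ}
    (hk : LieModule.lowerCentralSeries K Q V k = ⊥) (x : Q) (v : V) : ⁅x, v⁆ = 0 := by
  have key : ∀ k, ∀ (x : Q) (v : V), ⁅x, v⁆ ∈ LieModule.lowerCentralSeries K Q V k := by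
    intro k
    induction k with
    | zero => simp
    | succ k ih =>
      intro x v
      have hx : x ∈ Submodule.span K {z : Q | ∃ x y : Q, z = ⁅x, y⁆} := by
        rw [span_lie_eq_top]; trivial
      induction hx using Submodule.span_induction with
      | mem x hx =>
        obtain ⟨x, y, rfl⟩ := hx
        rw [lie_lie, LieModule.lowerCentralSeries_succ]
        exact sub_mem (LieSubmodule.lie_mem_lie trivial (ih _ _))
          (LieSubmodule.lie_mem_lie trivial (ih _ _))
      | zero => simp
      | add a b _ _ ha hb => rw [add_lie]; exact add_mem ha hb
      | smul c a _ ha => rw [smul_lie]; exact Submodule.smul_mem _ _ ha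
  simpa [hk] using key k x v

lemma lie_eq_zero_of_traceForm_eq_zero [FiniteDimensional K V]
    (h : LieModule.traceForm K Q V = 0) (x : Q) (v : V) : ⁅x, v⁆ = 0 := by
  have h1 := LieModule.isNilpotent_derivedSeries_of_traceForm_eq_zero (R := K) (L := Q) (M := V) h
  have htop : LieAlgebra.derivedSeries K Q 1 = ⊤ := by
    rw [LieAlgebra.derivedSeries_def, LieAlgebra.derivedSeriesOfIdeal_succ,
      LieAlgebra.derivedSeriesOfIdeal_zero, eq_top_iff]
    intro x _
    have hx : x ∈ Submodule.span K {z : Q | ∃ x y : Q, z = ⁅x, y⁆} := by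
      rw [span_lie_eq_top]; trivial
    have : Submodule.span K {z : Q | ∃ x y : Q, z = ⁅x, y⁆} ≤
        (⁅(⊤ : LieIdeal K Q), (⊤ : LieIdeal K Q)⁆ : LieIdeal K Q).toSubmodule := by
      rw [Submodule.span_le]
      rintro _ ⟨x, y, rfl⟩
      exact LieSubmodule.lie_mem_lie trivial trivial
    exact this hx
  rw [htop] at h1
  have : LieModule.IsNilpotent Q V :=
    (_root_.Equiv.lieModule_isNilpotent_iff (R := K) LieIdeal.topEquiv (1 : V ≃ₗ[K] V)
      fun _ _ => rfl).1 h1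
  obtain ⟨k, hk⟩ := LieModule.IsNilpotent.nilpotent K Q V
  exact lie_eq_zero_of_lowerCentralSeries_eq_bot hk x v

lemma exists_casimir [FiniteDimensional K V] (h : ∃ (x : Q) (v : V), ⁅x, v⁆ ≠ 0) :
    ∃ (n : ℕ) (e e' : Fin n → Q),
      (∀ x : Q, ∑ i, (⁅x, e i⁆ ⊗ₜ[K] e' i + e i ⊗ₜ[K] ⁅x, e' i⁆) = 0) ∧
      ∃ v : V, ∑ i, ⁅e i, ⁅e' i, v⁆⁆ ≠ 0 := by
  let B := LieModule.traceForm K Q V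
  have hBinv : ∀ x y z, B ⁅x, y⁆ z = B x ⁅y, z⁆ := LieModule.traceForm_apply_lie_apply K Q V
  have hBsymm : ∀ x y, B x y = B y x := LieModule.traceForm_comm K Q V
  let I : LieIdeal K Q :=
    { LinearMap.ker B with
      lie_mem := by
        intro x m hm
        have hm' : B m = 0 := hm
        change B ⁅x, m⁆ = 0
        ext y
        rw [hBsymm, ← hBinv, hBsymm, hm']
        simp }
  have hI : ∀ x, x ∈ I ↔ B x = 0 := fun x => Iff.rfl
  let J : LieIdeal K Q := LieIdeal.killingCompl K Q I
  have hIJ : IsCompl I J := LieIdeal.isCompl_killingCompl (K := K) (L := Q) I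
  have hsplit : ∀ y : Q, ∃ a ∈ I, ∃ b ∈ J, a + b = y := fun y => by
    have : y ∈ I ⊔ J := by rw [hIJ.sup_eq_top]; trivial
    exact (LieSubmodule.mem_sup _ _ _).1 this
  let P : Submodule K Q := J.toSubmodule
  let B1 : LinearMap.BilinForm K P := B.domRestrict₁₂ P P
  have hB1 : ∀ x y : P, B1 x y = B x y := fun _ _ => rfl
  have hnd1 : ∀ x : P, (∀ y, B1 x y = 0) → x = 0 := by
    intro x hx
    have hxI : (x : Q) ∈ I := by
      rw [hI]
      ext y
      obtain ⟨a, ha, b, hb, rfl⟩ := hsplit y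
      rw [map_add, hBsymm _ a, (hI a).1 ha]
      simpa [hB1] using hx ⟨b, hb⟩
    have : (x : Q) ∈ I ⊓ J := ⟨hxI, x.2⟩
    rw [hIJ.inf_eq_bot, LieSubmodule.mem_bot] at this
    exact Subtype.ext this
  have hnd : B1.Nondegenerate := by
    refine ⟨hnd1, fun x hx => hnd1 x fun y => ?_⟩
    rw [hB1, hBsymm]
    exact hx y
  let b := Module.finBasis K P
  let b' := LinearMap.BilinForm.dualBasis B1 hnd b
  have hbb' : ∀ i j, B1 (b' i) (b j) = if j = i then 1 else 0 := fun i j =>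
    LinearMap.BilinForm.apply_dualBasis_left hnd b i j
  have hexp' : ∀ y : P, y = ∑ j, B1 y (b j) • b' j := fun y => by
    conv_lhs => rw [← b'.sum_repr y]
    simp [b']
  have hexp : ∀ y : P, y = ∑ j, B1 (b' j) y • b j := fun y => by
    conv_lhs => rw [← b.sum_repr y]
    refine Finset.sum_congr rfl fun j _ => ?_
    congr 1
    have := congrArg (B1 (b' j)) (b.sum_repr y)
    simp only [map_sum, map_smul, hbb', smul_eq_mul] at this
    simpa using this
  refine ⟨_, fun i => (b' i : Q), fun i => (b i : Q), fun x => ?_, ?_⟩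
  · let ax : ∀ y : P, P := fun y => ⟨⁅x, (y : Q)⁆, J.lie_mem y.2⟩
    have h1 : ∀ i, ⁅x, (b' i : Q)⁆ = ∑ j, B ⁅x, (b' i : Q)⁆ (b j) • (b' j : Q) := fun i => by
      have := congrArg (Subtype.val) (hexp' (ax (b' i)))
      simpa [hB1, ax] using this
    have h2 : ∀ i, ⁅x, (b i : Q)⁆ = ∑ j, B (b' j) ⁅x, (b i : Q)⁆ • (b j : Q) := fun i => by
      have := congrArg (Subtype.val) (hexp (ax (b i)))
      simpa [hB1, ax] using this
    have h3 : ∑ i, ⁅x, (b' i : Q)⁆ ⊗ₜ[K] (b i : Q) =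
        ∑ i, ∑ j, (B ⁅x, (b' i : Q)⁆ (b j) • (b' j : Q)) ⊗ₜ[K] (b i : Q) :=
      Finset.sum_congr rfl fun i _ => by
        conv_lhs => rw [h1 i]
        rw [TensorProduct.sum_tmul]
    have h4 : ∑ i, (b' i : Q) ⊗ₜ[K] ⁅x, (b i : Q)⁆ =
        ∑ i, ∑ j, (b' i : Q) ⊗ₜ[K] (B (b' j) ⁅x, (b i : Q)⁆ • (b j : Q)) :=
      Finset.sum_congr rfl fun i _ => by
        conv_lhs => rw [h2 i]
        rw [TensorProduct.tmul_sum]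
    rw [Finset.sum_add_distrib, h3, h4, Finset.sum_comm, ← Finset.sum_add_distrib]
    refine Finset.sum_eq_zero fun i _ => ?_
    rw [← Finset.sum_add_distrib]
    refine Finset.sum_eq_zero fun j _ => ?_
    rw [TensorProduct.smul_tmul, ← TensorProduct.tmul_add, ← add_smul, ← hBinv,
      ← lie_skew x (b' j : Q), map_neg, LinearMap.neg_apply, neg_add_cancel, zero_smul,
      TensorProduct.tmul_zero]
  · by_contra! hc
    have htr : ∑ i, B (b' i : Q) (b i : Q) = 0 := by
      have : ∑ i, (LieModule.toEnd K Q V (b' i : Q) ∘ₗ LieModule.toEnd K Q V (b i : Q)) = 0 := by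
        ext v
        simpa using hc v
      have := congrArg (LinearMap.trace K V) this
      simpa [B, LieModule.traceForm_apply_apply] using this
    have hn : Module.finrank K P = 0 := by
      have h1 : ∀ i, B (b' i : Q) (b i : Q) = 1 := fun i => by
        rw [← hB1, hbb']; simp
      simpa [h1] using htr
    obtain ⟨x, v, hxv⟩ := h
    refine hxv (lie_eq_zero_of_traceForm_eq_zero (K := K) ?_ x v)
    ext y z
    obtain ⟨a, ha, c, hc, rfl⟩ := hsplit y
    have : P = ⊥ := Submodule.finrank_eq_zero.1 hn
    have hc' : c ∈ P := hc
    rw [this, Submodule.mem_bot] at hc'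
    change B (a + c) z = 0
    rw [hc', add_zero, (hI a).1 ha]
    rfl

section Balanced

variable {n : ℕ} {e e' : Fin n → Q}

lemma sum_lie_add_lie_eq_zero
    (he : ∀ x : Q, ∑ i, (⁅x, e i⁆ ⊗ₜ[K] e' i + e i ⊗ₜ[K] ⁅x, e' i⁆) = 0)
    (ψ : Q →ₗ[K] V) (x : Q) : ∑ i, (⁅⁅x, e i⁆, ψ (e' i)⁆ + ⁅e i, ψ ⁅x, e' i⁆⁆) = 0 := by
  have := congrArg
    (TensorProduct.lift ((LieModule.toEnd K Q V : Q →ₗ[K] Module.End K V).compl₂ ψ)) (he x)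
  simpa using this

/-- The Casimir operator attached to an invariant element of `Q ⊗ Q`. -/
def casimirHom (he : ∀ x : Q, ∑ i, (⁅x, e i⁆ ⊗ₜ[K] e' i + e i ⊗ₜ[K] ⁅x, e' i⁆) = 0) :
    V →ₗ⁅K, Q⁆ V :=
  { ∑ i, (LieModule.toEnd K Q V (e i) ∘ₗ LieModule.toEnd K Q V (e' i)) with
    map_lie' := by
      intro x v
      have h := sum_lie_add_lie_eq_zero he
        ((LieModule.toEnd K Q V : Q →ₗ[K] Module.End K V).flip v) x
      simp only [LinearMap.flip_apply, LieHom.coe_toLinearMap, LieModule.toEnd_apply_apply] at h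
      suffices ∑ i, ⁅e i, ⁅e' i, ⁅x, v⁆⁆⁆ = ⁅x, ∑ i, ⁅e i, ⁅e' i, v⁆⁆⁆ by simpa using this
      rw [lie_sum, ← sub_eq_zero, ← Finset.sum_sub_distrib, ← neg_eq_zero, ← h,
        ← Finset.sum_neg_distrib]
      refine Finset.sum_congr rfl fun i _ => ?_
      simp only [lie_lie, lie_sub]
      abel }

lemma casimirHom_apply (he : ∀ x : Q, ∑ i, (⁅x, e i⁆ ⊗ₜ[K] e' i + e i ⊗ₜ[K] ⁅x, e' i⁆) = 0)
    (v : V) : casimirHom he v = ∑ i, ⁅e i, ⁅e' i, v⁆⁆ := by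
  change (∑ i, (LieModule.toEnd K Q V (e i) ∘ₗ LieModule.toEnd K Q V (e' i))) v = _
  simp

end Balanced

variable (K Q V) in
/-- Every `1`-cocycle of `Q` with values in `V` is a coboundary. -/
def CocyclesOneAreCoboundaries : Prop :=
  ∀ ψ : Q →ₗ[K] V, (∀ x y, ψ ⁅x, y⁆ = ⁅x, ψ y⁆ - ⁅y, ψ x⁆) → ∃ v : V, ∀ x, ψ x = ⁅x, v⁆

variable (K Q V) in
/-- Every `2`-cocycle of `Q` with values in `V` is a coboundary. -/
def CocyclesTwoAreCoboundaries : Prop :=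
  ∀ ω : Q →ₗ[K] Q →ₗ[K] V, (∀ x, ω x x = 0) →
    (∀ x y z, ⁅x, ω y z⁆ + ⁅y, ω z x⁆ + ⁅z, ω x y⁆ = ω ⁅x, y⁆ z + ω ⁅y, z⁆ x + ω ⁅z, x⁆ y) →
    ∃ h : Q →ₗ[K] V, ∀ x y, ω x y = ⁅x, h y⁆ - ⁅y, h x⁆ - h ⁅x, y⁆

lemma map_swap_of_alternating {M : Type*} [AddCommGroup M] [Module K M] {ω : Q →ₗ[K] Q →ₗ[K] M}
    (h : ∀ x, ω x x = 0) (x y : Q) : ω y x = - ω x y := by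
  have := h (x + y)
  simp only [map_add, LinearMap.add_apply, h, zero_add, add_zero] at this
  exact eq_neg_of_add_eq_zero_left this

lemma cocyclesOne_of_trivial (h : ∀ (x : Q) (v : V), ⁅x, v⁆ = 0) :
    CocyclesOneAreCoboundaries K Q V := by
  intro ψ hψ
  refine ⟨0, fun x => ?_⟩
  rw [linearMap_eq_zero_of_lie ψ fun x y => by simp [hψ, h]]
  simp

lemma cocyclesTwo_scalar (ω : Q →ₗ[K] Q →ₗ[K] K) (hω : ∀ x, ω x x = 0)
    (hc : ∀ x y z, ω ⁅x, y⁆ z + ω ⁅y, z⁆ x + ω ⁅z, x⁆ y = 0) :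
    ∃ h : Q →ₗ[K] K, ∀ x y, ω x y = h ⁅x, y⁆ := by
  choose D hD using fun x => exists_killingForm_eq (K := K) (ω x)
  have hext : ∀ {a b : Q}, (∀ y, killingForm K Q a y = killingForm K Q b y) → a = b := by
    intro a b h
    rw [← sub_eq_zero]
    exact eq_zero_of_killingForm_eq_zero (K := K) fun y => by simp [h]
  have hinv := LieModule.traceForm_apply_lie_apply K Q Q
  have hsymm := LieModule.traceForm_comm K Q Q
  let Dl : Q →ₗ[K] Q :=
    { toFun := D
      map_add' := fun a b => hext fun y => by simp [hD]
      map_smul' := fun c a => hext fun y => by simp [hD] }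
  have hDer : ∀ a b, Dl ⁅a, b⁆ = ⁅a, Dl b⁆ - ⁅b, Dl a⁆ := by
    intro a b
    refine hext fun y => ?_
    have h1 : killingForm K Q ⁅a, D b⁆ y = ω b ⁅y, a⁆ := by
      rw [← lie_skew, map_neg, LinearMap.neg_apply, hinv, hD, ← lie_skew, map_neg, neg_neg]
    have h2 : killingForm K Q ⁅b, D a⁆ y = ω a ⁅y, b⁆ := by
      rw [← lie_skew, map_neg, LinearMap.neg_apply, hinv, hD, ← lie_skew, map_neg, neg_neg]
    change killingForm K Q (D ⁅a, b⁆) y = killingForm K Q (⁅a, D b⁆ - ⁅b, D a⁆) y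
    rw [map_sub, LinearMap.sub_apply, h1, h2, hD]
    have h3 := hc a b y
    rw [map_swap_of_alternating hω a, map_swap_of_alternating hω b, ← lie_skew b y, map_neg] at h3
    linear_combination h3
  obtain ⟨z, hz⟩ := LieDerivation.IsKilling.exists_eq_ad (LieDerivation.mk Dl hDer)
  refine ⟨killingForm K Q z, fun x y => ?_⟩
  have hzx : ⁅z, x⁆ = Dl x := by
    simpa using congrArg (fun d : LieDerivation K Q Q => d x) hz
  rw [← hD, ← hinv, hzx]
  rfl

lemma cocyclesTwo_of_trivial [FiniteDimensional K V] (h : ∀ (x : Q) (v : V), ⁅x, v⁆ = 0) :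
    CocyclesTwoAreCoboundaries K Q V := by
  intro ω hω hc
  let b := Module.finBasis K V
  have : ∀ i, ∃ g : Q →ₗ[K] K, ∀ x y, b.coord i (ω x y) = g ⁅x, y⁆ := fun i =>
    cocyclesTwo_scalar (ω.compr₂ (b.coord i)) (fun x => by simp [hω]) fun x y z => by
      have := congrArg (b.coord i) (hc x y z)
      simp only [h, add_zero, map_zero, map_add] at this
      exact this.symm
  choose g hg using this
  refine ⟨-∑ i, (g i).smulRight (b i), fun x y => ?_⟩
  rw [h, h, ← b.sum_repr (ω x y)]
  simp [← hg]

section Injective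

variable {n : ℕ} {e e' : Fin n → Q}

lemma casimirHom_cocycleOne
    (he : ∀ x : Q, ∑ i, (⁅x, e i⁆ ⊗ₜ[K] e' i + e i ⊗ₜ[K] ⁅x, e' i⁆) = 0)
    {ψ : Q →ₗ[K] V} (hψ : ∀ x y, ψ ⁅x, y⁆ = ⁅x, ψ y⁆ - ⁅y, ψ x⁆) (x : Q) :
    casimirHom he (ψ x) = ⁅x, ∑ i, ⁅e i, ψ (e' i)⁆⁆ := by
  rw [casimirHom_apply, lie_sum, ← sub_eq_zero, ← Finset.sum_sub_distrib, ← neg_eq_zero,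
    ← sum_lie_add_lie_eq_zero he ψ x, ← Finset.sum_neg_distrib]
  refine Finset.sum_congr rfl fun i _ => ?_
  simp only [hψ, lie_lie, lie_sub]
  abel

lemma casimirHom_cocycleTwo
    (he : ∀ x : Q, ∑ i, (⁅x, e i⁆ ⊗ₜ[K] e' i + e i ⊗ₜ[K] ⁅x, e' i⁆) = 0)
    {ω : Q →ₗ[K] Q →ₗ[K] V} (hω : ∀ x, ω x x = 0)
    (hc : ∀ x y z, ⁅x, ω y z⁆ + ⁅y, ω z x⁆ + ⁅z, ω x y⁆ =
      ω ⁅x, y⁆ z + ω ⁅y, z⁆ x + ω ⁅z, x⁆ y) :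
    ∃ h : Q →ₗ[K] V, ∀ x y, casimirHom he (ω x y) = ⁅x, h y⁆ - ⁅y, h x⁆ - h ⁅x, y⁆ := by
  refine ⟨∑ i, (LieModule.toEnd K Q V (e i)) ∘ₗ ω (e' i), fun x y => ?_⟩
  have h1 := sum_lie_add_lie_eq_zero he (ω.flip y) x
  have h2 := sum_lie_add_lie_eq_zero he (ω.flip x) y
  rw [casimirHom_apply]
  simp only [LinearMap.sum_apply, LinearMap.comp_apply, LieModule.toEnd_apply_apply, lie_sum,
    LinearMap.flip_apply] at h1 h2 ⊢
  rw [← sub_eq_zero, ← sub_eq_zero.2 (h2.trans h1.symm), ← Finset.sum_sub_distrib,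
    ← Finset.sum_sub_distrib, ← Finset.sum_sub_distrib, ← Finset.sum_sub_distrib]
  refine Finset.sum_congr rfl fun i _ => ?_
  have h3 := congrArg (fun v => ⁅e i, v⁆) (hc (e' i) x y)
  simp only [lie_add] at h3
  rw [map_swap_of_alternating hω (e' i) y, ← lie_skew (e' i) x, map_neg, LinearMap.neg_apply,
    map_swap_of_alternating hω (e' i) ⁅x, y⁆] at h3
  simp only [lie_neg] at h3
  rw [leibniz_lie x (e i), leibniz_lie y (e i)]
  rw [← sub_eq_zero] at h3 ⊢
  rw [← h3]
  abel

end Injective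

lemma cocycles_of_casimir_injective [FiniteDimensional K V] {n : ℕ} {e e' : Fin n → Q}
    (he : ∀ x : Q, ∑ i, (⁅x, e i⁆ ⊗ₜ[K] e' i + e i ⊗ₜ[K] ⁅x, e' i⁆) = 0)
    (hinj : Function.Injective (casimirHom (V := V) he)) :
    CocyclesOneAreCoboundaries K Q V ∧ CocyclesTwoAreCoboundaries K Q V := by
  have hinj' : Function.Injective ((casimirHom (V := V) he : V →ₗ⁅K, Q⁆ V) : V →ₗ[K] V) := hinj
  have hsurj : Function.Surjective (casimirHom (V := V) he) :=
    LinearMap.injective_iff_surjective.1 hinj'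
  constructor
  · intro ψ hψ
    obtain ⟨v, hv⟩ := hsurj (∑ i, ⁅e i, ψ (e' i)⁆)
    refine ⟨v, fun x => hinj ?_⟩
    rw [casimirHom_cocycleOne he hψ, ← hv, LieModuleHom.map_lie]
  · intro ω hω hc
    obtain ⟨h, hh⟩ := casimirHom_cocycleTwo he hω hc
    obtain ⟨s, hs⟩ := LinearMap.exists_rightInverse_of_surjective
      ((casimirHom (V := V) he : V →ₗ⁅K, Q⁆ V) : V →ₗ[K] V) (LinearMap.range_eq_top.2 hsurj)
    have hs' : ∀ v, casimirHom he (s v) = v := fun v => LinearMap.congr_fun hs v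
    refine ⟨s ∘ₗ h, fun x y => hinj ?_⟩
    rw [hh]
    simp [hs']

/-- Vanishing of cohomology for the kernel and the range of an endomorphism implies vanishing of
cohomology for the module. -/
lemma cocyclesOne_of_hom (c : V →ₗ⁅K, Q⁆ V) (hr : CocyclesOneAreCoboundaries K Q c.range)
    (hk : CocyclesOneAreCoboundaries K Q c.ker) : CocyclesOneAreCoboundaries K Q V := by
  intro ψ hψ
  let p : V →ₗ[K] c.range := (c : V →ₗ[K] V).codRestrict c.range.toSubmodule
    fun v => (LieModuleHom.mem_range c _).2 ⟨v, rfl⟩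
  have hp : ∀ v, (p v : V) = c v := fun _ => rfl
  obtain ⟨⟨_, v, rfl⟩, hv⟩ := hr (p ∘ₗ ψ) fun x y => by
    ext
    simp [hp, hψ]
  have hv' : ∀ x, c (ψ x) = c ⁅x, v⁆ := fun x => by
    simpa [hp] using congrArg Subtype.val (hv x)
  let ψ' : Q →ₗ[K] c.ker := LinearMap.codRestrict c.ker.toSubmodule
    (ψ - (LieModule.toEnd K Q V : Q →ₗ[K] Module.End K V).flip v) fun x => by simp [hv']
  have hψ' : ∀ x, (ψ' x : V) = ψ x - ⁅x, v⁆ := fun _ => rfl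
  obtain ⟨u, hu⟩ := hk ψ' fun x y => by
    ext
    simp only [LieSubmodule.coe_sub, LieSubmodule.coe_bracket, hψ', hψ, lie_sub, lie_lie]
    abel
  refine ⟨v + u, fun x => ?_⟩
  have h1 := congrArg Subtype.val (hu x)
  rw [hψ', LieSubmodule.coe_bracket, sub_eq_iff_eq_add] at h1
  rw [h1, lie_add, add_comm]

lemma cocyclesTwo_of_hom (c : V →ₗ⁅K, Q⁆ V) (hr : CocyclesTwoAreCoboundaries K Q c.range)
    (hk : CocyclesTwoAreCoboundaries K Q c.ker) : CocyclesTwoAreCoboundaries K Q V := by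
  intro ω hω hc
  let p : V →ₗ[K] c.range := (c : V →ₗ[K] V).codRestrict c.range.toSubmodule
    fun v => (LieModuleHom.mem_range c _).2 ⟨v, rfl⟩
  have hp : ∀ v, (p v : V) = c v := fun _ => rfl
  have hps : Function.Surjective p := by
    rintro ⟨_, v, rfl⟩
    exact ⟨v, rfl⟩
  obtain ⟨s, hs⟩ := LinearMap.exists_rightInverse_of_surjective p (LinearMap.range_eq_top.2 hps)
  have hpl : ∀ (x : Q) v, p ⁅x, v⁆ = ⁅x, p v⁆ := fun x v => Subtype.ext (by simp [hp])
  obtain ⟨h, hh⟩ := hr (ω.compr₂ p) (fun x => by simp [hω]) fun x y z => by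
    simpa [hpl] using congrArg p (hc x y z)
  have hsh : ∀ x, p (s (h x)) = h x := fun x => LinearMap.congr_fun hs (h x)
  let g : Q →ₗ[K] V := s ∘ₗ h
  let δ : Q →ₗ[K] Q →ₗ[K] V := LinearMap.mk₂ K (fun x y => ⁅x, g y⁆ - ⁅y, g x⁆ - g ⁅x, y⁆)
    (by intros; simp only [add_lie, map_add, lie_add]; abel)
    (by intros; simp only [smul_lie, map_smul, lie_smul, smul_sub])
    (by intros; simp only [add_lie, map_add, lie_add]; abel)
    (by intros; simp only [smul_lie, map_smul, lie_smul, smul_sub])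
  have hδ : ∀ x y, δ x y = ⁅x, g y⁆ - ⁅y, g x⁆ - g ⁅x, y⁆ := fun _ _ => rfl
  let ω' : Q →ₗ[K] Q →ₗ[K] c.ker := LinearMap.mk₂ K
    (fun x y => ⟨ω x y - δ x y, by
      have h1 : p (ω x y - δ x y) = 0 := by
        have := hh x y
        simp only [LinearMap.compr₂_apply] at this
        simp [hδ, hpl, g, hsh, this]
      have h2 := congrArg Subtype.val h1
      simpa [hp] using h2⟩)
    (by intros; ext; simp only [map_add, LinearMap.add_apply, LieSubmodule.coe_add]; abel)
    (by intros; ext; simp [smul_sub])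
    (by intros; ext; simp only [map_add, LieSubmodule.coe_add]; abel)
    (by intros; ext; simp [smul_sub])
  have hω' : ∀ x y, (ω' x y : V) = ω x y - δ x y := fun _ _ => rfl
  obtain ⟨h', hh'⟩ := hk ω' (fun x => by ext; simp [hω', hω, hδ]) fun x y z => by
    ext
    simp only [LieSubmodule.coe_add, LieSubmodule.coe_bracket, hω', hδ]
    have h3 := sub_eq_zero.2 (hc x y z)
    have h4 := congrArg g (lie_jacobi x y z)
    have h5 : ∀ a b : Q, g ⁅a, b⁆ = -g ⁅b, a⁆ := fun a b => by rw [← lie_skew, map_neg]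
    simp only [map_add, map_zero] at h4
    rw [h5 ⁅x, y⁆ z, h5 ⁅y, z⁆ x, h5 ⁅z, x⁆ y, ← sub_eq_zero,
      ← sub_eq_zero.2 (h3.trans (neg_eq_zero.2 h4).symm)]
    simp only [lie_sub, lie_lie]
    abel
  let q : Q →ₗ[K] V := c.ker.toSubmodule.subtype ∘ₗ h'
  have hq : ∀ x, (h' x : V) = q x := fun _ => rfl
  refine ⟨g + q, fun x y => ?_⟩
  have h6 := congrArg Subtype.val (hh' x y)
  rw [hω', sub_eq_iff_eq_add, hδ] at h6
  rw [h6]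
  simp only [LieSubmodule.coe_sub, LieSubmodule.coe_bracket, hq, LinearMap.add_apply, lie_add]
  abel

variable (K Q) in
/-- **Whitehead's lemmas**: the first and second cohomology of a Killing Lie algebra with values
in a finite-dimensional module vanish. -/
theorem cocycles_are_coboundaries (V : Type v) [AddCommGroup V] [Module K V] [LieRingModule Q V]
    [LieModule K Q V] [FiniteDimensional K V] :
    CocyclesOneAreCoboundaries K Q V ∧ CocyclesTwoAreCoboundaries K Q V := by
  induction hd : Module.finrank K V using Nat.strong_induction_on generalizing V with
  | _ d ih =>
  by_cases htriv : ∀ (x : Q) (v : V), ⁅x, v⁆ = 0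
  · exact ⟨cocyclesOne_of_trivial htriv, cocyclesTwo_of_trivial htriv⟩
  push Not at htriv
  obtain ⟨n, e, e', he, v, hv⟩ := exists_casimir (K := K) htriv
  rw [← casimirHom_apply he] at hv
  by_cases hinj : Function.Injective (casimirHom (V := V) he)
  · exact cocycles_of_casimir_injective he hinj
  let c : V →ₗ⁅K, Q⁆ V := casimirHom he
  have hsum : Module.finrank K c.range + Module.finrank K c.ker = Module.finrank K V :=
    LinearMap.finrank_range_add_finrank_ker (c : V →ₗ[K] V)
  have hr0 : 0 < Module.finrank K c.range := by
    rw [Module.finrank_pos_iff_exists_ne_zero]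
    exact ⟨⟨c v, (LieModuleHom.mem_range c _).2 ⟨v, rfl⟩⟩, fun h => hv (congrArg Subtype.val h)⟩
  have hk0 : 0 < Module.finrank K c.ker := by
    have : ¬ Function.Injective ((c : V →ₗ⁅K, Q⁆ V) : V →ₗ[K] V) := hinj
    rw [← LinearMap.ker_eq_bot, Submodule.eq_bot_iff] at this
    push Not at this
    obtain ⟨u, hu, hu0⟩ := this
    rw [Module.finrank_pos_iff_exists_ne_zero]
    exact ⟨⟨u, hu⟩, fun h => hu0 (congrArg Subtype.val h)⟩
  have hr := ih _ (by omega) c.range rfl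
  have hk := ih _ (by omega) c.ker rfl
  exact ⟨cocyclesOne_of_hom c hr.1 hk.1, cocyclesTwo_of_hom c hr.2 hk.2⟩

/-- Whitehead's first lemma for an action given by a linear map into the endomorphisms. -/
lemma exists_eq_of_cocycleOne (V : Type v) [AddCommGroup V] [Module K V] [FiniteDimensional K V]
    (ρ : Q →ₗ[K] Module.End K V) (hρ : ∀ x y v, ρ ⁅x, y⁆ v = ρ x (ρ y v) - ρ y (ρ x v))
    (ψ : Q →ₗ[K] V) (hψ : ∀ x y, ψ ⁅x, y⁆ = ρ x (ψ y) - ρ y (ψ x)) :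
    ∃ v : V, ∀ x, ψ x = ρ x v := by
  let : LieRingModule Q V :=
    { bracket := fun x v => ρ x v
      add_lie := fun x y v => by simp
      lie_add := fun x v w => by simp
      leibniz_lie := fun x y v => by rw [hρ]; abel }
  have : LieModule K Q V :=
    { smul_lie := fun c x v => by change ρ (c • x) v = c • ρ x v; simp
      lie_smul := fun c x v => by change ρ x (c • v) = c • ρ x v; simp }
  exact (cocycles_are_coboundaries K Q V).1 ψ hψ

/-- Whitehead's second lemma for an action given by a linear map into the endomorphisms. -/
lemma exists_eq_of_cocycleTwo (V : Type v) [AddCommGroup V] [Module K V] [FiniteDimensional K V]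
    (ρ : Q →ₗ[K] Module.End K V) (hρ : ∀ x y v, ρ ⁅x, y⁆ v = ρ x (ρ y v) - ρ y (ρ x v))
    (ω : Q →ₗ[K] Q →ₗ[K] V) (hω : ∀ x, ω x x = 0)
    (hc : ∀ x y z, ρ x (ω y z) + ρ y (ω z x) + ρ z (ω x y) =
      ω ⁅x, y⁆ z + ω ⁅y, z⁆ x + ω ⁅z, x⁆ y) :
    ∃ h : Q →ₗ[K] V, ∀ x y, ω x y = ρ x (h y) - ρ y (h x) - h ⁅x, y⁆ := by
  let : LieRingModule Q V :=
    { bracket := fun x v => ρ x v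
      add_lie := fun x y v => by simp
      lie_add := fun x v w => by simp
      leibniz_lie := fun x y v => by rw [hρ]; abel }
  have : LieModule K Q V :=
    { smul_lie := fun c x v => by change ρ (c • x) v = c • ρ x v; simp
      lie_smul := fun c x v => by change ρ x (c • v) = c • ρ x v; simp }
  exact (cocycles_are_coboundaries K Q V).2 ω hω hc

section Levi

variable {L : Type v} [LieRing L] [LieAlgebra K L] [FiniteDimensional K L]

lemma exists_improved_section {A B : LieIdeal K L} (hAB : ⁅A, A⁆ ≤ B) (g : Q →ₗ[K] L)
    (hg : ∀ x y, ⁅g x, g y⁆ - g ⁅x, y⁆ ∈ A) :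
    ∃ h : Q →ₗ[K] L, (∀ x, h x ∈ A) ∧
      ∀ x y, ⁅g x, g y⁆ - g ⁅x, y⁆ - ⁅g x, h y⁆ + ⁅g y, h x⁆ + h ⁅x, y⁆ ∈ B := by
  let N : LieSubmodule K L A := LieSubmodule.comap (LieSubmodule.incl A) B
  have hN : ∀ a : A, (LieSubmodule.Quotient.mk' N a = 0) ↔ (a : L) ∈ B := fun a => by
    rw [LieSubmodule.Quotient.mk_eq_zero]
    rfl
  let ρ : Q →ₗ[K] Module.End K (A ⧸ N) :=
    (LieModule.toEnd K L (A ⧸ N) : L →ₗ[K] Module.End K (A ⧸ N)) ∘ₗ g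
  have hρmk : ∀ x (a : A), ρ x (LieSubmodule.Quotient.mk' N a) =
      LieSubmodule.Quotient.mk' N ⁅g x, a⁆ := fun x a => rfl
  let φ : Q →ₗ[K] Q →ₗ[K] A := LinearMap.mk₂ K (fun x y => ⟨⁅g x, g y⁆ - g ⁅x, y⁆, hg x y⟩)
    (by intros; ext; simp only [map_add, add_lie, LieSubmodule.coe_add]; abel)
    (by intros; ext; simp [smul_sub])
    (by intros; ext; simp only [map_add, lie_add, LieSubmodule.coe_add]; abel)
    (by intros; ext; simp [smul_sub])
  have hφ : ∀ x y, (φ x y : L) = ⁅g x, g y⁆ - g ⁅x, y⁆ := fun _ _ => rfl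
  let π : A →ₗ[K] A ⧸ N := (LieSubmodule.Quotient.mk' N : A →ₗ⁅K, L⁆ A ⧸ N)
  have hπ : Function.Surjective π := LieSubmodule.Quotient.surjective_mk' N
  have hπ0 : ∀ a : A, π a = 0 ↔ (a : L) ∈ B := hN
  have hρπ : ∀ x (a : A), ρ x (π a) = π ⁅g x, a⁆ := hρmk
  obtain ⟨s, hs⟩ := LinearMap.exists_rightInverse_of_surjective π (LinearMap.range_eq_top.2 hπ)
  have hπs : ∀ v, π (s v) = v := fun v => LinearMap.congr_fun hs v
  obtain ⟨h, hh⟩ := exists_eq_of_cocycleTwo (A ⧸ N) ρ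
    (fun x y v => by
      obtain ⟨a, rfl⟩ := hπ v
      rw [hρπ, hρπ, hρπ, hρπ, hρπ, ← map_sub, ← sub_eq_zero, ← map_sub, hπ0, ← neg_mem_iff]
      have : -((⁅g ⁅x, y⁆, a⁆ - (⁅g x, ⁅g y, a⁆⁆ - ⁅g y, ⁅g x, a⁆⁆) : A) : L) =
          ⁅⁅g x, g y⁆ - g ⁅x, y⁆, (a : L)⁆ := by
        simp [sub_lie, lie_lie]
      rw [this]
      exact hAB (LieSubmodule.lie_mem_lie (hg x y) a.2))
    (φ.compr₂ π)
    (fun x => by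
      have : φ x x = 0 := by ext; simp [hφ]
      simp [this])
    (fun x y z => by
      simp only [LinearMap.compr₂_apply, hρπ, ← map_add]
      congr 1
      ext
      simp only [LieSubmodule.coe_add, LieSubmodule.coe_bracket, hφ, lie_sub]
      have h1 := lie_jacobi (g x) (g y) (g z)
      have h2 := congrArg g (lie_jacobi x y z)
      have h3 : ∀ a b : Q, g ⁅a, b⁆ = -g ⁅b, a⁆ := fun a b => by rw [← lie_skew, map_neg]
      simp only [map_add, map_zero] at h2
      rw [h3 ⁅x, y⁆ z, h3 ⁅y, z⁆ x, h3 ⁅z, x⁆ y, ← lie_skew (g x) (g ⁅y, z⁆),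
        ← lie_skew (g y) (g ⁅z, x⁆), ← lie_skew (g z) (g ⁅x, y⁆), ← sub_eq_zero,
        ← sub_eq_zero.2 (h1.trans h2.symm)]
      abel)
  refine ⟨A.toSubmodule.subtype ∘ₗ s ∘ₗ h, fun x => (s (h x)).2, fun x y => ?_⟩
  have h1 := hh x y
  rw [LinearMap.compr₂_apply, ← hπs (h y), ← hπs (h x), ← hπs (h ⁅x, y⁆), hρπ, hρπ, ← map_sub,
    ← map_sub, ← sub_eq_zero, ← map_sub, hπ0] at h1
  convert h1 using 1
  simp only [LieSubmodule.coe_sub, LieSubmodule.coe_bracket, hφ]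
  change _ - _ - ⁅g x, (s (h y) : L)⁆ + ⁅g y, (s (h x) : L)⁆ + (s (h ⁅x, y⁆) : L) = _
  abel

variable {σ : L →ₗ⁅K⁆ L} {τ : Q →ₗ⁅K⁆ Q}

lemma map_mem_derivedSeriesOfIdeal {I : LieIdeal K L} (hσ : ∀ x ∈ I, σ x ∈ I) (k : ℕ) :
    ∀ x ∈ LieAlgebra.derivedSeriesOfIdeal K L k I,
      σ x ∈ LieAlgebra.derivedSeriesOfIdeal K L k I := by
  induction k with
  | zero => exact hσ
  | succ k ih =>
    rw [LieAlgebra.derivedSeriesOfIdeal_succ]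
    intro x hx
    rw [← LieSubmodule.mem_toSubmodule, LieSubmodule.lieIdeal_oper_eq_linear_span'] at hx
    induction hx using Submodule.span_induction with
    | mem x hx =>
      obtain ⟨a, ha, b, hb, rfl⟩ := hx
      rw [LieHom.map_lie]
      exact LieSubmodule.lie_mem_lie (ih a ha) (ih b hb)
    | zero => simp
    | add a b _ _ ha hb => rw [map_add]; exact add_mem ha hb
    | smul c a _ ha => rw [map_smul]; exact Submodule.smul_mem _ _ ha

lemma exists_improved_equivariant_section {A B : LieIdeal K L} (hAB : ⁅A, A⁆ ≤ B)
    (hσ : ∀ x, σ (σ x) = x) (hτ : ∀ x, τ (τ x) = x) (hσA : ∀ x ∈ A, σ x ∈ A)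
    (hσB : ∀ x ∈ B, σ x ∈ B) (g : Q →ₗ[K] L) (hgσ : ∀ x, σ (g x) = g (τ x))
    (hg : ∀ x y, ⁅g x, g y⁆ - g ⁅x, y⁆ ∈ A) :
    ∃ g' : Q →ₗ[K] L, (∀ x, g x - g' x ∈ A) ∧ (∀ x, σ (g' x) = g' (τ x)) ∧
      ∀ x y, ⁅g' x, g' y⁆ - g' ⁅x, y⁆ ∈ B := by
  obtain ⟨h, hhA, hh⟩ := exists_improved_section hAB g hg
  let h' : Q →ₗ[K] L := (2⁻¹ : K) • (h + (σ : L →ₗ[K] L) ∘ₗ h ∘ₗ (τ : Q →ₗ[K] Q))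
  have hh' : ∀ x, h' x = (2⁻¹ : K) • (h x + σ (h (τ x))) := fun _ => rfl
  have hh'A : ∀ x, h' x ∈ A := fun x =>
    A.smul_mem _ (add_mem (hhA x) (hσA _ (hhA _)))
  have key : ∀ x y, ⁅g x, g y⁆ - g ⁅x, y⁆ - ⁅g x, h' y⁆ + ⁅g y, h' x⁆ + h' ⁅x, y⁆ ∈ B := by
    intro x y
    have h1 := hh x y
    have h2 := hσB _ (hh (τ x) (τ y))
    simp only [map_add, map_sub, LieHom.map_lie, hgσ, hτ] at h2
    have h3 := B.smul_mem (2⁻¹ : K) (add_mem h1 h2)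
    convert (LieSubmodule.mem_toSubmodule B).1 h3 using 1
    simp only [hh', lie_smul, lie_add, LieHom.map_lie]
    match_scalars <;> norm_num
  refine ⟨g - h', fun x => by simpa using hh'A x, fun x => ?_, fun x y => ?_⟩
  · simp only [LinearMap.sub_apply, map_sub, hgσ, hh', map_smul, map_add, hσ, hτ]
    rw [add_comm]
  · have h1 := add_mem (key x y) (hAB (LieSubmodule.lie_mem_lie (hh'A x) (hh'A y)))
    convert h1 using 1
    simp only [LinearMap.sub_apply, lie_sub, sub_lie]
    rw [← lie_skew (g y)]
    abel

/-- The **Levi theorem** for Lie algebras, in a version equivariant under an involution. -/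
theorem exists_equivariant_splitting (hσ : ∀ x, σ (σ x) = x) (hτ : ∀ x, τ (τ x) = x)
    (f : L →ₗ⁅K⁆ Q) (hf : Function.Surjective f) (hfσ : ∀ x, f (σ x) = τ (f x))
    [LieAlgebra.IsSolvable f.ker] :
    ∃ g : Q →ₗ⁅K⁆ L, (∀ x, f (g x) = x) ∧ ∀ x, σ (g x) = g (τ x) := by
  have hσk : ∀ x ∈ f.ker, σ x ∈ f.ker := fun x hx => by
    rw [LieHom.mem_ker] at hx ⊢
    rw [hfσ, hx, map_zero]
  let D := fun k => LieAlgebra.derivedSeriesOfIdeal K L k f.ker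
  have main : ∀ k, ∃ g : Q →ₗ[K] L, (∀ x, f (g x) = x) ∧ (∀ x, σ (g x) = g (τ x)) ∧
      ∀ x y, ⁅g x, g y⁆ - g ⁅x, y⁆ ∈ D k := by
    intro k
    induction k with
    | zero =>
      obtain ⟨s, hs⟩ := LinearMap.exists_rightInverse_of_surjective (f : L →ₗ[K] Q)
        (LinearMap.range_eq_top.2 hf)
      have hs' : ∀ x, f (s x) = x := fun x => LinearMap.congr_fun hs x
      let g : Q →ₗ[K] L := (2⁻¹ : K) • (s + (σ : L →ₗ[K] L) ∘ₗ s ∘ₗ (τ : Q →ₗ[K] Q))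
      have hg : ∀ x, g x = (2⁻¹ : K) • (s x + σ (s (τ x))) := fun _ => rfl
      have hfg : ∀ x, f (g x) = x := fun x => by
        rw [hg, map_smul, map_add, hfσ, hs', hs', hτ, ← two_smul K x, smul_smul]
        norm_num
      refine ⟨g, hfg, fun x => ?_, fun x y => ?_⟩
      · simp only [hg, map_smul, map_add, hσ, hτ]
        rw [add_comm]
      · change _ ∈ f.ker
        rw [LieHom.mem_ker, map_sub, LieHom.map_lie, hfg, hfg, hfg, sub_self]
    | succ k ih =>
      obtain ⟨g, hfg, hgσ, hg⟩ := ih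
      obtain ⟨g', h1, h2, h3⟩ := exists_improved_equivariant_section (A := D k) (B := D (k + 1))
        (le_of_eq (LieAlgebra.derivedSeriesOfIdeal_succ K L f.ker k).symm) hσ hτ
        (map_mem_derivedSeriesOfIdeal hσk k) (map_mem_derivedSeriesOfIdeal hσk (k + 1)) g hgσ hg
      refine ⟨g', fun x => ?_, h2, h3⟩
      have h4 : g x - g' x ∈ f.ker := LieAlgebra.derivedSeriesOfIdeal_le_self _ k (h1 x)
      rw [LieHom.mem_ker, map_sub, hfg, sub_eq_zero] at h4
      exact h4.symm
  obtain ⟨k, hk⟩ := LieAlgebra.IsSolvable.solvable K f.ker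
  rw [LieIdeal.derivedSeries_eq_bot_iff] at hk
  obtain ⟨g, hfg, hgσ, hg⟩ := main k
  refine ⟨{ g with map_lie' := fun {x y} => ?_ }, hfg, hgσ⟩
  have := hg x y
  rw [show D k = ⊥ from hk, LieSubmodule.mem_bot, sub_eq_zero] at this
  exact this.symm

end Levi

section ModuleLift

variable {U : Type v} [AddCommGroup U] [Module K U] [FiniteDimensional K U]

/-- An equivariant surjection from a finite-dimensional module onto the adjoint module of a
Killing Lie algebra splits equivariantly. -/
lemma exists_splitting_of_surjective_to_adjoint
    (ρ : Q →ₗ[K] Module.End K U) (hρ : ∀ x y v, ρ ⁅x, y⁆ v = ρ x (ρ y v) - ρ y (ρ x v))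
    (F : U →ₗ[K] Q) (hF : Function.Surjective F) (hFρ : ∀ x u, F (ρ x u) = ⁅x, F u⁆) :
    ∃ G : Q →ₗ[K] U, (∀ x, F (G x) = x) ∧ ∀ x y, G ⁅x, y⁆ = ρ x (G y) := by
  obtain ⟨s, hs⟩ := LinearMap.exists_rightInverse_of_surjective F (LinearMap.range_eq_top.2 hF)
  have hFs : ∀ x, F (s x) = x := fun x => LinearMap.congr_fun hs x
  let N := LinearMap.ker F
  have hMext : ∀ {m m' : Q →ₗ[K] N}, (∀ y, (m y : U) = m' y) → m = m' := fun h =>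
    LinearMap.ext fun y => Subtype.ext (h y)
  let A : Q → (Q →ₗ[K] N) → (Q →ₗ[K] N) := fun x m => LinearMap.codRestrict N
    (ρ x ∘ₗ N.subtype ∘ₗ m - N.subtype ∘ₗ m ∘ₗ (LieAlgebra.ad K Q x)) fun y => by
      have : F (m y) = 0 := (m y).2
      have h' : F (m ⁅x, y⁆) = 0 := (m ⁅x, y⁆).2
      simp [N, hFρ, this, h']
  have hA : ∀ x m y, (A x m y : U) = ρ x (m y) - m ⁅x, y⁆ := fun _ _ _ => rfl
  let R : Q →ₗ[K] Module.End K (Q →ₗ[K] N) := LinearMap.mk₂ K A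
    (fun x x' m => hMext fun y => by simp [hA]; abel)
    (fun c x m => hMext fun y => by simp [hA, smul_sub])
    (fun x m m' => hMext fun y => by simp [hA]; abel)
    (fun c x m => hMext fun y => by simp [hA, smul_sub])
  have hR : ∀ x m y, (R x m y : U) = ρ x (m y) - m ⁅x, y⁆ := fun _ _ _ => rfl
  let ψ : Q →ₗ[K] Q →ₗ[K] N := LinearMap.mk₂ K
    (fun x y => ⟨ρ x (s y) - s ⁅x, y⁆, by simp [N, hFρ, hFs]⟩)
    (fun x x' m => Subtype.ext (by simp; abel))
    (fun c x m => Subtype.ext (by simp [smul_sub]))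
    (fun x m m' => Subtype.ext (by simp; abel))
    (fun c x m => Subtype.ext (by simp [smul_sub]))
  have hψ : ∀ x y, (ψ x y : U) = ρ x (s y) - s ⁅x, y⁆ := fun _ _ => rfl
  obtain ⟨m, hm⟩ := exists_eq_of_cocycleOne (Q →ₗ[K] N) R
    (fun x y m => hMext fun z => by
      simp only [hR, hρ, LinearMap.sub_apply, Submodule.coe_sub, lie_lie, map_sub]
      abel) ψ
    (fun x y => hMext fun z => by
      simp only [hR, hψ, hρ, LinearMap.sub_apply, Submodule.coe_sub, lie_lie, map_sub]
      abel)
  refine ⟨s - N.subtype ∘ₗ m, fun x => ?_, fun x y => ?_⟩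
  · have : F (m x) = 0 := (m x).2
    simp [hFs, this]
  · have h1 := congrArg (fun n : Q →ₗ[K] N => (n y : U)) (hm x)
    simp only [hR, hψ] at h1
    simp only [LinearMap.sub_apply, LinearMap.comp_apply, Submodule.subtype_apply, map_sub]
    rw [sub_eq_sub_iff_add_eq_add] at h1 ⊢
    rw [add_comm, ← h1, add_comm]

lemma exists_equivariant_splitting_of_surjective_to_adjoint
    (ρ : Q →ₗ[K] Module.End K U) (hρ : ∀ x y v, ρ ⁅x, y⁆ v = ρ x (ρ y v) - ρ y (ρ x v))
    (F : U →ₗ[K] Q) (hF : Function.Surjective F) (hFρ : ∀ x u, F (ρ x u) = ⁅x, F u⁆)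
    {σ : U →ₗ[K] U} {τ : Q →ₗ⁅K⁆ Q} (hσ : ∀ x, σ (σ x) = x) (hτ : ∀ x, τ (τ x) = x)
    (hFσ : ∀ u, F (σ u) = τ (F u)) (hρσ : ∀ x u, σ (ρ x u) = ρ (τ x) (σ u)) :
    ∃ G : Q →ₗ[K] U, (∀ x, F (G x) = x) ∧ (∀ x y, G ⁅x, y⁆ = ρ x (G y)) ∧
      ∀ x, σ (G x) = G (τ x) := by
  obtain ⟨G, hFG, hG⟩ := exists_splitting_of_surjective_to_adjoint ρ hρ F hF hFρ
  refine ⟨(2⁻¹ : K) • (G + σ ∘ₗ G ∘ₗ (τ : Q →ₗ[K] Q)), fun x => ?_, fun x y => ?_, fun x => ?_⟩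
  · simp only [LinearMap.smul_apply, LinearMap.add_apply, LinearMap.comp_apply,
      LieHom.coe_toLinearMap, map_smul, map_add, hFσ, hFG, hτ]
    rw [← two_smul K x, smul_smul]
    norm_num
  · simp [hG, hρσ, hτ]
  · simp only [LinearMap.smul_apply, LinearMap.add_apply, LinearMap.comp_apply,
      LieHom.coe_toLinearMap, map_smul, map_add, hσ, hτ]
    rw [add_comm]

end ModuleLift

section LeviDecomposition

variable {L : Type v} [LieRing L] [LieAlgebra K L] [FiniteDimensional K L]

/-- The quotient map by a Lie ideal, as a homomorphism of Lie algebras. -/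
def quotientLieHom (I : LieIdeal K L) : L →ₗ⁅K⁆ (L ⧸ I) :=
  { (LieSubmodule.Quotient.mk' I : L →ₗ[K] (L ⧸ I)) with map_lie' := rfl }

lemma quotientLieHom_surjective (I : LieIdeal K L) :
    Function.Surjective (quotientLieHom I) :=
  LieSubmodule.Quotient.surjective_mk' I

lemma quotientLieHom_eq_zero {I : LieIdeal K L} {x : L} : quotientLieHom I x = 0 ↔ x ∈ I :=
  LieSubmodule.Quotient.mk_eq_zero I

variable (K L) in
/-- The quotient of a finite-dimensional Lie algebra by its radical has trivial radical. -/
lemma hasTrivialRadical_quotient_radical :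
    LieAlgebra.HasTrivialRadical K (L ⧸ LieAlgebra.radical K L) := by
  rw [LieAlgebra.hasTrivialRadical_iff_no_abelian_ideals]
  intro J hJ
  let π := quotientLieHom (LieAlgebra.radical K L)
  have hI : ⁅J.comap π, J.comap π⁆ ≤ LieAlgebra.radical K L := by
    rw [LieSubmodule.lieIdeal_oper_eq_span, LieSubmodule.lieSpan_le]
    rintro _ ⟨⟨a, ha⟩, ⟨b, hb⟩, rfl⟩
    rw [LieIdeal.mem_comap] at ha hb
    refine quotientLieHom_eq_zero.1 ?_
    rw [LieHom.map_lie]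
    exact congrArg Subtype.val (LieModule.IsTrivial.trivial (⟨π a, ha⟩ : J) (⟨π b, hb⟩ : J))
  obtain ⟨k, hk⟩ := LieAlgebra.IsSolvable.solvable K (LieAlgebra.radical K L)
  rw [LieIdeal.derivedSeries_eq_bot_iff] at hk
  have hsol : LieAlgebra.IsSolvable (J.comap π) := by
    refine LieAlgebra.IsSolvable.mk (R := K) (k := k + 1) ?_
    rw [LieIdeal.derivedSeries_eq_bot_iff, LieAlgebra.derivedSeriesOfIdeal_add, eq_bot_iff, ← hk]
    refine LieAlgebra.derivedSeriesOfIdeal_le ?_ le_rfl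
    simpa using hI
  rw [LieAlgebra.LieIdeal.solvable_iff_le_radical] at hsol
  rw [eq_bot_iff]
  intro x hx
  obtain ⟨y, rfl⟩ := quotientLieHom_surjective _ x
  rw [LieSubmodule.mem_bot]
  exact quotientLieHom_eq_zero.2 (hsol hx)

lemma map_mem_radical {σ : L →ₗ⁅K⁆ L} (hσ : ∀ x, σ (σ x) = x) {x : L}
    (hx : x ∈ LieAlgebra.radical K L) : σ x ∈ LieAlgebra.radical K L := by
  let R := LieAlgebra.radical K L
  let f : R.comap σ →ₗ⁅K⁆ R :=
    { toFun := fun x => ⟨σ x, x.2⟩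
      map_add' := fun x y => Subtype.ext (by simp)
      map_smul' := fun c x => Subtype.ext (by simp)
      map_lie' := fun {x y} => Subtype.ext (by simp) }
  have hf : Function.Injective f := fun x y h => Subtype.ext <| by
    rw [← hσ x, ← hσ y]
    exact congrArg (fun z : R => σ z) h
  have hsol : LieAlgebra.IsSolvable (R.comap σ) := hf.lieAlgebra_isSolvable
  rw [LieAlgebra.LieIdeal.solvable_iff_le_radical] at hsol
  refine hsol ?_
  rw [LieIdeal.mem_comap, hσ]
  exact hx

/-- An involution of a Lie algebra induces one of its quotient by the radical. -/
lemma exists_involution_quotient_radical {σ : L →ₗ⁅K⁆ L} (hσ : ∀ x, σ (σ x) = x) :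
    ∃ τ : (L ⧸ LieAlgebra.radical K L) →ₗ⁅K⁆ (L ⧸ LieAlgebra.radical K L),
      (∀ x, τ (τ x) = x) ∧ ∀ x, quotientLieHom _ (σ x) = τ (quotientLieHom _ x) := by
  let R := LieAlgebra.radical K L
  let m : (L ⧸ R) →ₗ[K] (L ⧸ R) := Submodule.mapQ R.toSubmodule R.toSubmodule (σ : L →ₗ[K] L)
    fun x hx => map_mem_radical hσ hx
  have hm : ∀ x, m (quotientLieHom R x) = quotientLieHom R (σ x) := fun _ => rfl
  refine ⟨{ m with map_lie' := fun {x y} => ?_ }, fun x => ?_, fun x => (hm x).symm⟩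
  · obtain ⟨x, rfl⟩ := quotientLieHom_surjective R x
    obtain ⟨y, rfl⟩ := quotientLieHom_surjective R y
    change m _ = ⁅m _, m _⁆
    rw [← LieHom.map_lie, hm, hm, hm, LieHom.map_lie, LieHom.map_lie]
  · obtain ⟨x, rfl⟩ := quotientLieHom_surjective R x
    change m (m _) = _
    rw [hm, hm, hσ]

end LeviDecomposition

section EquivariantLevi

variable {L : Type v} [LieRing L] [LieAlgebra K L] [FiniteDimensional K L]
variable {U : Type v} [AddCommGroup U] [Module K U] [FiniteDimensional K U]
  [LieRingModule L U] [LieModule K L U]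

/-- A Levi splitting of a Lie algebra `L` lifts through an equivariant surjection `U → L`,
compatibly with involutions of `L` and `U`. -/
lemma exists_equivariant_levi_lift (f : U →ₗ⁅K,L⁆ L) (hf : Function.Surjective f)
    {σ : U →ₗ[K] U} {s : L →ₗ⁅K⁆ L} (hσ : ∀ u, σ (σ u) = u) (hs : ∀ x, s (s x) = x)
    (hfσ : ∀ u, f (σ u) = s (f u)) (hσl : ∀ x u, σ ⁅x, u⁆ = ⁅s x, σ u⁆)
    (R : LieIdeal K L) (hR : R = LieAlgebra.radical K L) :
    ∃ (τ : (L ⧸ R) →ₗ⁅K⁆ (L ⧸ R)) (g : (L ⧸ R) →ₗ⁅K⁆ L) (G : (L ⧸ R) →ₗ[K] U),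
      (∀ x, quotientLieHom R (g x) = x) ∧ (∀ x, quotientLieHom R (s x) = τ (quotientLieHom R x)) ∧
      (∀ x, f (G x) = g x) ∧ (∀ x y, G ⁅x, y⁆ = ⁅g x, G y⁆) ∧ ∀ x, σ (G x) = G (τ x) := by
  subst hR
  have := hasTrivialRadical_quotient_radical K L
  have : IsKilling K (L ⧸ LieAlgebra.radical K L) := inferInstance
  obtain ⟨τ, hτ, hsτ⟩ := exists_involution_quotient_radical hs
  have hker : (quotientLieHom (LieAlgebra.radical K L)).ker = LieAlgebra.radical K L := by
    ext x
    rw [LieHom.mem_ker, quotientLieHom_eq_zero]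
  have : LieAlgebra.IsSolvable (quotientLieHom (LieAlgebra.radical K L)).ker := by
    rw [hker]; infer_instance
  obtain ⟨g, hg, hsg⟩ := exists_equivariant_splitting hs hτ _ (quotientLieHom_surjective _) hsτ
  let W : Submodule K U :=
    (LinearMap.range (g : (L ⧸ LieAlgebra.radical K L) →ₗ[K] L)).comap (f : U →ₗ[K] L)
  have hW : ∀ {u}, u ∈ W ↔ ∃ x, g x = f u := fun {u} => Iff.rfl
  let ρ : (L ⧸ LieAlgebra.radical K L) →ₗ[K] Module.End K W := LinearMap.mk₂ K
    (fun x u => ⟨⁅g x, (u : U)⁆, by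
      obtain ⟨y, hy⟩ := hW.1 u.2
      exact hW.2 ⟨⁅x, y⁆, by rw [LieHom.map_lie, LieModuleHom.map_lie, hy]⟩⟩)
    (fun x x' u => Subtype.ext (by simp))
    (fun c x u => Subtype.ext (by simp))
    (fun x u u' => Subtype.ext (by simp))
    (fun c x u => Subtype.ext (by simp))
  have hρ : ∀ x u, (ρ x u : U) = ⁅g x, (u : U)⁆ := fun _ _ => rfl
  let F : W →ₗ[K] (L ⧸ LieAlgebra.radical K L) :=
    (quotientLieHom (LieAlgebra.radical K L) : L →ₗ[K] (L ⧸ LieAlgebra.radical K L)) ∘ₗ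
      (f : U →ₗ[K] L) ∘ₗ W.subtype
  have hF : ∀ u, F u = quotientLieHom _ (f u) := fun _ => rfl
  let σ' : W →ₗ[K] W := σ.restrict fun u hu => by
    obtain ⟨y, hy⟩ := hW.1 hu
    exact hW.2 ⟨τ y, by rw [← hsg, hy, hfσ]⟩
  have hσ' : ∀ u, (σ' u : U) = σ u := fun _ => rfl
  obtain ⟨G, hFG, hG, hGσ⟩ := exists_equivariant_splitting_of_surjective_to_adjoint (U := W) ρ
    (fun x y v => Subtype.ext (by simp [hρ, lie_lie]))
    F (fun x => by
      obtain ⟨u, hu⟩ := hf (g x)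
      exact ⟨⟨u, hW.2 ⟨x, hu.symm⟩⟩, by rw [hF, hu, hg]⟩)
    (fun x u => by rw [hF, hF, hρ, LieModuleHom.map_lie, LieHom.map_lie, hg])
    (σ := σ') (fun u => Subtype.ext (by rw [hσ', hσ', hσ])) hτ
    (fun u => by rw [hF, hF, hσ', hfσ, hsτ])
    (fun x u => Subtype.ext (by rw [hσ', hρ, hρ, hσ', hσl, hsg]))
  refine ⟨τ, g, W.subtype ∘ₗ G, hg, hsτ, fun x => ?_, fun x y => ?_, fun x => ?_⟩
  · obtain ⟨y, hy⟩ := hW.1 (G x).2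
    have h := hFG x
    rw [hF, ← hy, hg] at h
    rw [LinearMap.comp_apply, Submodule.subtype_apply, ← hy, h]
  · simp [hG, hρ]
  · simp [← hσ', hGσ]

end EquivariantLevi

section Leibniz

attribute [local instance] LieRing.ofAssociativeRing

variable {U : Type v} [AddCommGroup U] [Module K U] [FiniteDimensional K U]

/-- The **Levi theorem** for right Leibniz algebras, in a version equivariant under an involution:
`F` is the quotient map by the radical and `G` is a section of it. The subspaces `D n` witness the
solvability of the radical. -/
theorem exists_levi_splitting_leibniz (B : U →ₗ[K] U →ₗ[K] U)
    (hB : ∀ x y z, B (B x y) z = B (B x z) y + B x (B y z))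
    {σ : U →ₗ[K] U} (hσ : ∀ u, σ (σ u) = u) (hσB : ∀ x y, σ (B x y) = B (σ x) (σ y)) :
    ∃ (Q : Type v) (_ : LieRing Q) (_ : LieAlgebra K Q) (_ : LieAlgebra.HasTrivialRadical K Q)
      (F : U →ₗ[K] Q) (G : Q →ₗ[K] U),
      (∀ x, F (G x) = x) ∧ (∀ x y, F (B x y) = ⁅F x, F y⁆) ∧
      (∀ x y, B (G x) (G y) = G ⁅x, y⁆) ∧ (∀ u, σ (G (F u)) = G (F (σ u))) ∧
      ∃ D : ℕ → Submodule K U, D 0 = LinearMap.ker F ∧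
        (∀ n, ∀ x ∈ D n, ∀ y, B x y ∈ D n ∧ B y x ∈ D n) ∧
        (∀ n, ∀ x ∈ D n, ∀ y ∈ D n, B x y ∈ D (n + 1)) ∧
        ∃ k, ∀ y ∈ D k, ∀ x, B x y = 0 := by
  let r : U →ₗ[K] Module.End K U := -B.flip
  have hr : ∀ x y, r x y = -B y x := fun _ _ => rfl
  have hrB : ∀ x y, r (B x y) = ⁅r x, r y⁆ := fun x y => LinearMap.ext fun u => by
    rw [LieRing.of_associative_ring_bracket, LinearMap.sub_apply, Module.End.mul_apply,
      Module.End.mul_apply, hr, hr, hr, hr, hr, map_neg, map_neg, LinearMap.neg_apply,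
      LinearMap.neg_apply, hB u x y]
    abel
  let L : LieSubalgebra K (Module.End K U) :=
    { LinearMap.range r with
      lie_mem' := by
        rintro _ _ ⟨x, rfl⟩ ⟨y, rfl⟩
        exact ⟨B x y, hrB x y⟩ }
  have hL : ∀ x : L, ∃ u, r u = x := fun x => x.2
  have hLact : ∀ (x : L) (u : U), ⁅x, u⁆ = (x : Module.End K U) u := fun _ _ => rfl
  let f : U →ₗ⁅K,L⁆ L :=
    { r.codRestrict L.toSubmodule fun u => ⟨u, rfl⟩ with
      map_lie' := fun {x u} => Subtype.ext <| by
        obtain ⟨y, hy⟩ := hL x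
        change r ⁅x, u⁆ = ⁅(x : Module.End K U), r u⁆
        rw [hLact, ← hy, hr, map_neg, hrB, lie_skew] }
  have hf : ∀ u, (f u : Module.End K U) = r u := fun _ => rfl
  have hfB : ∀ x y, f (B x y) = ⁅f x, f y⁆ := fun x y => Subtype.ext (hrB x y)
  have hfact : ∀ x y, ⁅f x, y⁆ = - B y x := fun _ _ => rfl
  have hσr : ∀ u, σ ∘ₗ r u ∘ₗ σ = r (σ u) := fun u => LinearMap.ext fun v => by
    simp [hr, hσB, hσ]
  let s : L →ₗ⁅K⁆ L :=
    { toFun := fun x => ⟨σ ∘ₗ (x : Module.End K U) ∘ₗ σ, by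
        obtain ⟨u, hu⟩ := hL x
        exact ⟨σ u, by rw [← hu, hσr]⟩⟩
      map_add' := fun x y => Subtype.ext (LinearMap.ext fun v => by simp)
      map_smul' := fun c x => Subtype.ext (LinearMap.ext fun v => by simp)
      map_lie' := fun {x y} => Subtype.ext <| LinearMap.ext fun v => by
        simp [LieRing.of_associative_ring_bracket, hσ] }
  have hs : ∀ (x : L) (u : U), ⁅s x, u⁆ = σ ⁅x, σ u⁆ := fun _ _ => rfl
  have hsf : ∀ u, f (σ u) = s (f u) := fun u => Subtype.ext (hσr u).symm
  obtain ⟨τ, g, G, hg, hτ, hfG, hG, hGσ⟩ := exists_equivariant_levi_lift f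
    (fun x => by
      obtain ⟨u, hu⟩ := hL x
      exact ⟨u, Subtype.ext hu⟩) hσ (s := s)
    (fun x => Subtype.ext <| LinearMap.ext fun v => by
      change σ (σ ((x : Module.End K U) (σ (σ v)))) = _
      rw [hσ, hσ]) hsf (fun x u => by rw [hs, hσ]) _ rfl
  obtain ⟨k, hk⟩ := LieAlgebra.IsSolvable.solvable K (LieAlgebra.radical K L)
  rw [LieIdeal.derivedSeries_eq_bot_iff] at hk
  let π := quotientLieHom (LieAlgebra.radical K L)
  refine ⟨L ⧸ LieAlgebra.radical K L, inferInstance, inferInstance,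
    hasTrivialRadical_quotient_radical K L, (π : L →ₗ[K] (L ⧸ LieAlgebra.radical K L)) ∘ₗ
    (f : U →ₗ[K] L), G, fun x => ?_, fun x y => ?_, fun x y => ?_, fun u => ?_,
    fun n => (LieAlgebra.derivedSeriesOfIdeal K L n
      (LieAlgebra.radical K L)).toSubmodule.comap (f : U →ₗ[K] L),
    ?_, fun n x hx y => ⟨?_, ?_⟩, fun n x hx y hy => ?_, k, fun y hy x => ?_⟩
  · change π (f (G x)) = x
    rw [hfG, hg]
  · change π (f (B x y)) = ⁅π (f x), π (f y)⁆
    rw [hfB, LieHom.map_lie]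
  · rw [← neg_neg (B (G x) (G y)), ← hfact, hfG, ← hG, ← lie_skew x, map_neg]
  · change σ (G (π (f u))) = G (π (f (σ u)))
    rw [hGσ, hsf, hτ]
  · ext x
    exact (quotientLieHom_eq_zero (I := LieAlgebra.radical K L) (x := f x)).symm
  · change f (B x y) ∈ LieAlgebra.derivedSeriesOfIdeal K L n (LieAlgebra.radical K L)
    rw [hfB, ← lie_skew]
    exact neg_mem (LieSubmodule.lie_mem _ hx)
  · change f (B y x) ∈ LieAlgebra.derivedSeriesOfIdeal K L n (LieAlgebra.radical K L)
    rw [hfB]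
    exact LieSubmodule.lie_mem _ hx
  · change f (B x y) ∈ LieAlgebra.derivedSeriesOfIdeal K L (n + 1) _
    rw [hfB, LieAlgebra.derivedSeriesOfIdeal_succ]
    exact LieSubmodule.lie_mem_lie hx hy
  · change f y ∈ LieAlgebra.derivedSeriesOfIdeal K L k _ at hy
    rw [hk, LieSubmodule.mem_bot] at hy
    rw [← neg_neg (B x y), ← hfact, hy, zero_lie, neg_zero]

end Leibniz

end Cohomology

section TripleIdeals

set_option linter.unusedSectionVars false

variable {L : Type*} [LieRing L] [LieAlgebra K L]

/-- `Y` is an ideal of the Lie triple system `P` inside the Lie algebra `L`. -/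
def IsTripleIdeal (P Y : Submodule K L) : Prop :=
  Y ≤ P ∧ ∀ x ∈ Y, ∀ a ∈ P, ∀ b ∈ P, ⁅⁅x, a⁆, b⁆ ∈ Y ∧ ⁅⁅a, b⁆, x⁆ ∈ Y

/-- The span of all `⁅⁅x, p⁆, y⁆` with `x, y ∈ Y` and `p ∈ P`. -/
def tripleDerived (P Y : Submodule K L) : Submodule K L :=
  Submodule.span K {z | ∃ x ∈ Y, ∃ p ∈ P, ∃ y ∈ Y, z = ⁅⁅x, p⁆, y⁆}

lemma lie_lie_mem_tripleDerived {P Y : Submodule K L} {x p y : L} (hx : x ∈ Y) (hp : p ∈ P)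
    (hy : y ∈ Y) : ⁅⁅x, p⁆, y⁆ ∈ tripleDerived P Y :=
  Submodule.subset_span ⟨x, hx, p, hp, y, hy, rfl⟩

lemma IsTripleIdeal.tripleDerived {P Y : Submodule K L} (hP : IsTripleIdeal P P)
    (hY : IsTripleIdeal P Y) : IsTripleIdeal P (tripleDerived P Y) := by
  refine ⟨Submodule.span_le.2 ?_, fun z hz a ha b hb => ?_⟩
  · rintro _ ⟨x, hx, p, hp, y, hy, rfl⟩
    exact hY.1 (hY.2 x hx p hp y (hY.1 hy)).1
  · induction hz using Submodule.span_induction with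
    | mem z hz =>
      obtain ⟨x, hx, p, hp, y, hy, rfl⟩ := hz
      have hxpa := (hY.2 x hx p hp a ha).1
      have hxpb := (hY.2 x hx p hp b hb).1
      have hyab := (hY.2 y hy a ha b hb).1
      constructor
      · have : ⁅⁅⁅⁅x, p⁆, y⁆, a⁆, b⁆ = ⁅⁅⁅⁅x, p⁆, a⁆, y⁆, b⁆ + ⁅⁅x, p⁆, ⁅⁅y, a⁆, b⁆⁆
            - ⁅⁅y, a⁆, ⁅⁅x, p⁆, b⁆⁆ := by
          have e1 : ⁅⁅⁅x, p⁆, y⁆, a⁆ = ⁅⁅⁅x, p⁆, a⁆, y⁆ + ⁅⁅x, p⁆, ⁅y, a⁆⁆ := by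
            rw [lie_lie ⁅x, p⁆ y a, ← lie_skew y ⁅⁅x, p⁆, a⁆]
            abel
          rw [e1, add_lie, lie_lie ⁅x, p⁆ ⁅y, a⁆ b]
          abel
        have e2 : ⁅⁅⁅⁅x, p⁆, a⁆, y⁆, b⁆ =
            ⁅⁅⁅⁅x, p⁆, a⁆, b⁆, y⁆ - ⁅⁅y, b⁆, ⁅⁅x, p⁆, a⁆⁆ := by
          rw [lie_lie ⁅⁅x, p⁆, a⁆ y b, ← lie_skew y ⁅⁅⁅x, p⁆, a⁆, b⁆, ← lie_skew ⁅y, b⁆]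
          abel
        rw [this, e2]
        exact sub_mem (add_mem (sub_mem (lie_lie_mem_tripleDerived hxpa hb hy)
          (lie_lie_mem_tripleDerived hy hb hxpa)) (lie_lie_mem_tripleDerived hx hp hyab))
          (lie_lie_mem_tripleDerived hy ha hxpb)
      · rw [leibniz_lie, leibniz_lie ⁅a, b⁆ x p, add_lie]
        exact add_mem (add_mem
          (lie_lie_mem_tripleDerived (hY.2 x hx a ha b hb).2 hp hy)
          (lie_lie_mem_tripleDerived hx (hP.2 p hp a ha b hb).2 hy))
          (lie_lie_mem_tripleDerived hx hp (hY.2 y hy a ha b hb).2)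
    | zero => simp
    | add z w _ _ hz hw =>
      simp only [add_lie, lie_add]
      exact ⟨add_mem hz.1 hw.1, add_mem hz.2 hw.2⟩
    | smul c z _ hz =>
      simp only [smul_lie, lie_smul]
      exact ⟨Submodule.smul_mem _ _ hz.1, Submodule.smul_mem _ _ hz.2⟩

variable [FiniteDimensional K L] [LieAlgebra.HasTrivialRadical K L]

/-- In a semisimple Lie algebra generated by `P + ⁅P, P⁆`, an ideal of `P` with trivial derived
system is zero. -/
lemma IsTripleIdeal.eq_bot_of_tripleDerived_eq_bot {P Y : Submodule K L}
    (hP : (⊤ : Submodule K L) ≤ P ⊔ Submodule.span K {z | ∃ a ∈ P, ∃ b ∈ P, z = ⁅a, b⁆})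
    (hY : IsTripleIdeal P Y) (h : _root_.tripleDerived P Y = ⊥) : Y = ⊥ := by
  have hgen : ∀ N : Submodule K L, (∀ a ∈ P, ∀ z ∈ N, ⁅a, z⁆ ∈ N) →
      ∀ q : L, ∀ z ∈ N, ⁅q, z⁆ ∈ N := by
    intro N hN q z hz
    obtain ⟨p, hp, r, hr, rfl⟩ := Submodule.mem_sup.1 (hP (Submodule.mem_top (x := q)))
    rw [add_lie]
    refine add_mem (hN p hp z hz) ?_
    induction hr using Submodule.span_induction with
    | mem r hr =>
      obtain ⟨a, ha, b, hb, rfl⟩ := hr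
      rw [lie_lie]
      exact sub_mem (hN a ha _ (hN b hb z hz)) (hN b hb _ (hN a ha z hz))
    | zero => simp
    | add r s _ _ hr hs => rw [add_lie]; exact add_mem hr hs
    | smul c r _ hr => rw [smul_lie]; exact Submodule.smul_mem _ _ hr
  have h3 : ∀ x ∈ Y, ∀ p ∈ P, ∀ y ∈ Y, ⁅⁅x, p⁆, y⁆ = 0 := fun x hx p hp y hy => by
    have := lie_lie_mem_tripleDerived hx hp hy
    rwa [h, Submodule.mem_bot] at this
  have h2 : ∀ x ∈ Y, ∀ y ∈ Y, ⁅x, y⁆ = 0 := by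
    intro x hx y hy
    have hc : ∀ q : L, ⁅q, ⁅x, y⁆⁆ = 0 := by
      intro q
      have hN : ∀ a ∈ P, ∀ z ∈ Submodule.span K {⁅x, y⁆}, ⁅a, z⁆ = 0 := by
        intro a ha z hz
        obtain ⟨c, rfl⟩ := Submodule.mem_span_singleton.1 hz
        rw [lie_smul, leibniz_lie, ← lie_skew a x, neg_lie, h3 x hx a ha y hy, ← lie_skew x,
          ← lie_skew a y, neg_lie, h3 y hy a ha x hx]
        simp
      obtain ⟨p, hp, r, hr, rfl⟩ := Submodule.mem_sup.1 (hP (Submodule.mem_top (x := q)))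
      rw [add_lie, hN p hp _ (Submodule.mem_span_singleton_self _), zero_add]
      induction hr using Submodule.span_induction with
      | mem r hr =>
        obtain ⟨a, ha, b, hb, rfl⟩ := hr
        rw [lie_lie, hN a ha _ (Submodule.mem_span_singleton_self _),
          hN b hb _ (Submodule.mem_span_singleton_self _)]
        simp
      | zero => simp
      | add r s _ _ hr hs => rw [add_lie, hr, hs, add_zero]
      | smul c r _ hr => rw [smul_lie, hr, smul_zero]
    have : ⁅x, y⁆ ∈ LieAlgebra.center K L := fun q => hc q
    rwa [LieAlgebra.center_eq_bot, LieSubmodule.mem_bot] at this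
  let Z : Submodule K L := Submodule.span K {z | ∃ x ∈ Y, ∃ p ∈ P, z = ⁅x, p⁆}
  let J : LieIdeal K L :=
    { Y ⊔ Z with
      lie_mem := fun {q m} hm => hgen (Y ⊔ Z) (fun a ha z hz => by
        obtain ⟨x, hx, w, hw, rfl⟩ := Submodule.mem_sup.1 hz
        rw [lie_add]
        refine add_mem ?_ ?_
        · rw [← lie_skew]
          exact Submodule.mem_sup_right (neg_mem (Submodule.subset_span ⟨x, hx, a, ha, rfl⟩))
        · refine Submodule.mem_sup_left ?_
          clear hz
          induction hw using Submodule.span_induction with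
          | mem r hr =>
            obtain ⟨x, hx, p, hp, rfl⟩ := hr
            rw [← lie_skew]
            exact neg_mem (hY.2 x hx p hp a ha).1
          | zero => simp
          | add r s _ _ hr hs => rw [lie_add]; exact add_mem hr hs
          | smul c r _ hr => rw [lie_smul]; exact Submodule.smul_mem _ _ hr) q m hm }
  have hYZ : ∀ w ∈ Z, ∀ y ∈ Y, ⁅w, y⁆ = 0 := by
    intro w hw y hy
    induction hw using Submodule.span_induction with
    | mem r hr =>
      obtain ⟨x, hx, p, hp, rfl⟩ := hr
      exact h3 x hx p hp y hy
    | zero => simp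
    | add r s _ _ hr hs => rw [add_lie, hr, hs, add_zero]
    | smul c r _ hr => rw [smul_lie, hr, smul_zero]
  have hZZ : ∀ w ∈ Z, ∀ w' ∈ Z, ⁅w, w'⁆ = 0 := by
    intro w hw w' hw'
    induction hw' using Submodule.span_induction with
    | mem r hr =>
      obtain ⟨y, hy, q, hq, rfl⟩ := hr
      rw [leibniz_lie, hYZ w hw y hy, zero_lie, zero_add]
      refine h2 y hy _ ?_
      induction hw using Submodule.span_induction with
      | mem r hr =>
        obtain ⟨x, hx, p, hp, rfl⟩ := hr
        exact (hY.2 x hx p hp q hq).1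
      | zero => simp
      | add r s _ _ hr hs => rw [add_lie]; exact add_mem hr hs
      | smul c r _ hr => rw [smul_lie]; exact Submodule.smul_mem _ _ hr
    | zero => simp
    | add r s _ _ hr hs => rw [lie_add, hr, hs, add_zero]
    | smul c r _ hr => rw [lie_smul, hr, smul_zero]
  have hJ : IsLieAbelian J := ⟨by
    rintro ⟨u, hu⟩ ⟨v, hv⟩
    obtain ⟨x, hx, w, hw, rfl⟩ := Submodule.mem_sup.1 hu
    obtain ⟨y, hy, w', hw', rfl⟩ := Submodule.mem_sup.1 hv
    refine Subtype.ext ?_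
    change ⁅x + w, y + w'⁆ = 0
    rw [add_lie, lie_add, lie_add, h2 x hx y hy, hYZ w hw y hy, hZZ w hw w' hw', ← lie_skew x,
      hYZ w' hw' x hx]
    simp⟩
  have hJ0 : J = ⊥ := LieAlgebra.HasTrivialRadical.eq_bot_of_isSolvable (R := K) J
  rw [eq_bot_iff]
  intro x hx
  have : x ∈ J := Submodule.mem_sup_left hx
  rwa [hJ0] at this

lemma IsTripleIdeal.eq_bot_of_iterate_tripleDerived_eq_bot {P Y : Submodule K L}
    (hP : (⊤ : Submodule K L) ≤ P ⊔ Submodule.span K {z | ∃ a ∈ P, ∃ b ∈ P, z = ⁅a, b⁆})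
    (hPP : IsTripleIdeal P P) (hY : IsTripleIdeal P Y) {k : ℕ}
    (h : (_root_.tripleDerived P)^[k] Y = ⊥) : Y = ⊥ := by
  induction k generalizing Y with
  | zero => exact h
  | succ k ih =>
    rw [Function.iterate_succ_apply] at h
    exact hY.eq_bot_of_tripleDerived_eq_bot hP (ih (hPP.tripleDerived hY) h)

end TripleIdeals

section Envelope

set_option linter.unusedSectionVars false

/-- The operator `c ↦ {cab} − {cba}` of right multiplication by `a ⊗ b`. -/
def rightMul (t : T →ₗ[K] T →ₗ[K] T →ₗ[K] T) : T →ₗ[K] T →ₗ[K] Module.End K T :=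
  LinearMap.mk₂ K (fun a b => (t.flip a).flip b - (t.flip b).flip a)
    (fun a a' b => LinearMap.ext fun c => by simp; abel)
    (fun r a b => LinearMap.ext fun c => by simp [smul_sub])
    (fun a b b' => LinearMap.ext fun c => by simp; abel)
    (fun r a b => LinearMap.ext fun c => by simp [smul_sub])

lemma rightMul_apply (t : T →ₗ[K] T →ₗ[K] T →ₗ[K] T) (a b c : T) :
    rightMul t a b c = t c a b - t c b a := rfl

/-- The span of the pairs of left and right multiplications by the elements `a ⊗ b`. -/
def innerPairs (t : T →ₗ[K] T →ₗ[K] T →ₗ[K] T) :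
    Submodule K (Module.End K T × Module.End K T) :=
  Submodule.span K {w | ∃ a b, w = (t a b, rightMul t a b)}

/-- The bracket on `T × (End T × End T)` extending that of the standard embedding of `T`. -/
def embBracket (t : T →ₗ[K] T →ₗ[K] T →ₗ[K] T) :
    (T × Module.End K T × Module.End K T) →ₗ[K] (T × Module.End K T × Module.End K T) →ₗ[K]
      (T × Module.End K T × Module.End K T) :=
  LinearMap.mk₂ K
    (fun x y => (x.2.1 y.1 + y.2.2 x.1,
      t x.1 y.1 + y.2.2 ∘ₗ x.2.1 + x.2.1 ∘ₗ y.2.1,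
      rightMul t x.1 y.1 + y.2.2 ∘ₗ x.2.2 - x.2.2 ∘ₗ y.2.2))
    (fun x x' y => by
      refine Prod.ext ?_ (Prod.ext (LinearMap.ext fun c => ?_) (LinearMap.ext fun c => ?_)) <;>
      simp <;> abel)
    (fun r x y => by
      refine Prod.ext ?_ (Prod.ext (LinearMap.ext fun c => ?_) (LinearMap.ext fun c => ?_)) <;>
      simp [smul_add, smul_sub])
    (fun x y y' => by
      refine Prod.ext ?_ (Prod.ext (LinearMap.ext fun c => ?_) (LinearMap.ext fun c => ?_)) <;>
      simp <;> abel)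
    (fun r x y => by
      refine Prod.ext ?_ (Prod.ext (LinearMap.ext fun c => ?_) (LinearMap.ext fun c => ?_)) <;>
      simp [smul_add, smul_sub])

lemma embBracket_apply (t : T →ₗ[K] T →ₗ[K] T →ₗ[K] T)
    (x y : T × Module.End K T × Module.End K T) :
    embBracket t x y = (x.2.1 y.1 + y.2.2 x.1,
      t x.1 y.1 + y.2.2 ∘ₗ x.2.1 + x.2.1 ∘ₗ y.2.1,
      rightMul t x.1 y.1 + y.2.2 ∘ₗ x.2.2 - x.2.2 ∘ₗ y.2.2) := rfl

variable {t : T →ₗ[K] T →ₗ[K] T →ₗ[K] T}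

lemma innerPairs_left (h1 : LTS1 t) {w : Module.End K T × Module.End K T}
    (hw : w ∈ innerPairs t) (a b c : T) : t a (w.1 b) c = - t a (w.2 b) c := by
  induction hw using Submodule.span_induction with
  | mem w hw =>
    obtain ⟨d, e, rfl⟩ := hw
    simp only [rightMul_apply, map_sub, LinearMap.sub_apply, h1 a]
    abel
  | zero => simp
  | add w w' _ _ hw hw' => simp [hw, hw']; abel
  | smul r w _ hw => simp [hw]

lemma innerPairs_right (h2 : LTS2 t) {w : Module.End K T × Module.End K T}
    (hw : w ∈ innerPairs t) (a b c : T) : t a b (w.1 c) = - t a b (w.2 c) := by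
  induction hw using Submodule.span_induction with
  | mem w hw =>
    obtain ⟨d, e, rfl⟩ := hw
    simp only [rightMul_apply, map_sub, h2 a b]
    abel
  | zero => simp
  | add w w' _ _ hw hw' => simp [hw, hw']; abel
  | smul r w _ hw => simp [hw]

lemma innerPairs_apply_fst (h2 : LTS2 t) {w w' : Module.End K T × Module.End K T}
    (hw : w ∈ innerPairs t) (hw' : w' ∈ innerPairs t) (c : T) :
    w.1 (w'.1 c) = - w.1 (w'.2 c) := by
  induction hw using Submodule.span_induction with
  | mem w hw =>
    obtain ⟨d, e, rfl⟩ := hw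
    exact innerPairs_right h2 hw' d e c
  | zero => simp
  | add w w' _ _ hw hw' => simp [hw, hw']; abel
  | smul r w _ hw => simp [hw]

lemma innerPairs_derivation (h1 : LTS1 t) (h2 : LTS2 t) {w : Module.End K T × Module.End K T}
    (hw : w ∈ innerPairs t) (a b c : T) :
    w.2 (t a b c) = t (w.2 a) b c + t a (w.2 b) c + t a b (w.2 c) := by
  induction hw using Submodule.span_induction with
  | mem w hw =>
    obtain ⟨d, e, rfl⟩ := hw
    simp only [rightMul_apply, map_sub, LinearMap.sub_apply, h1 a, h2 a b]
    abel
  | zero => simp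
  | add w w' _ _ hw hw' => simp [hw, hw']; abel
  | smul r w _ hw => simp [hw]

lemma innerPairs_fst_apply (h2 : LTS2 t) {w : Module.End K T × Module.End K T}
    (hw : w ∈ innerPairs t) (a b c : T) :
    w.1 (t a b c) = t (w.1 a) b c - t (w.1 b) a c - t (w.1 c) a b + t (w.1 c) b a := by
  induction hw using Submodule.span_induction with
  | mem w hw =>
    obtain ⟨d, e, rfl⟩ := hw
    exact h2 d e a b c
  | zero => simp
  | add w w' _ _ hw hw' => simp [hw, hw']; abel
  | smul r w _ hw => simp [hw, smul_sub]

lemma innerPairs_bracket_mem (h1 : LTS1 t) (h2 : LTS2 t)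
    {w w' : Module.End K T × Module.End K T} (hw : w ∈ innerPairs t) (hw' : w' ∈ innerPairs t) :
    (w'.2 ∘ₗ w.1 + w.1 ∘ₗ w'.1, w'.2 ∘ₗ w.2 - w.2 ∘ₗ w'.2) ∈ innerPairs t := by
  induction hw' using Submodule.span_induction with
  | mem w' hw' =>
    obtain ⟨a, b, rfl⟩ := hw'
    have : ((rightMul t a b ∘ₗ w.1 + w.1 ∘ₗ t a b,
        rightMul t a b ∘ₗ w.2 - w.2 ∘ₗ rightMul t a b) : Module.End K T × Module.End K T) =
        (t (w.1 a) b, rightMul t (w.1 a) b) - (t (w.1 b) a, rightMul t (w.1 b) a) := by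
      refine Prod.ext (LinearMap.ext fun c => ?_) (LinearMap.ext fun c => ?_)
      · simp only [LinearMap.add_apply, LinearMap.comp_apply, rightMul_apply, Prod.fst_sub,
          LinearMap.sub_apply, innerPairs_fst_apply h2 hw]
        abel
      · simp only [LinearMap.comp_apply, rightMul_apply, Prod.snd_sub,
          LinearMap.sub_apply, map_sub, innerPairs_derivation h1 h2 hw, innerPairs_left h1 hw,
          innerPairs_right h2 hw]
        abel
    rw [this]
    exact sub_mem (Submodule.subset_span ⟨_, _, rfl⟩) (Submodule.subset_span ⟨_, _, rfl⟩)
  | zero =>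
    convert zero_mem (innerPairs t) using 1
    simp
  | add x y _ _ hx hy =>
    convert add_mem hx hy using 1
    simp [LinearMap.add_comp, LinearMap.comp_add]
    constructor <;> abel
  | smul r x _ hx =>
    convert Submodule.smul_mem _ r hx using 1
    simp [LinearMap.smul_comp, LinearMap.comp_smul, smul_sub]

lemma embBracket_mem (h1 : LTS1 t) (h2 : LTS2 t) {x y : T × Module.End K T × Module.End K T}
    (hx : x.2 ∈ innerPairs t) (hy : y.2 ∈ innerPairs t) :
    (embBracket t x y).2 ∈ innerPairs t := by
  have hmem : (t x.1 y.1, rightMul t x.1 y.1) ∈ innerPairs t :=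
    Submodule.subset_span ⟨x.1, y.1, rfl⟩
  have h : (embBracket t x y).2 = (t x.1 y.1, rightMul t x.1 y.1) +
      (y.2.2 ∘ₗ x.2.1 + x.2.1 ∘ₗ y.2.1, y.2.2 ∘ₗ x.2.2 - x.2.2 ∘ₗ y.2.2) := by
    rw [embBracket_apply]
    simp [add_assoc, add_sub_assoc]
  rw [h]
  exact add_mem hmem (innerPairs_bracket_mem h1 h2 hx hy)

lemma embBracket_leibniz (h1 : LTS1 t) (h2 : LTS2 t)
    {x y z : T × Module.End K T × Module.End K T}
    (hx : x.2 ∈ innerPairs t) (hy : y.2 ∈ innerPairs t) (hz : z.2 ∈ innerPairs t) :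
    embBracket t (embBracket t x y) z =
      embBracket t (embBracket t x z) y + embBracket t x (embBracket t y z) := by
  obtain ⟨a, u⟩ := x
  obtain ⟨b, v⟩ := y
  obtain ⟨c, w⟩ := z
  simp only at hx hy hz
  refine Prod.ext ?_ (Prod.ext (LinearMap.ext fun d => ?_) (LinearMap.ext fun d => ?_))
  · simp only [embBracket_apply, Prod.fst_add, LinearMap.add_apply, LinearMap.sub_apply,
      LinearMap.comp_apply, map_add, rightMul_apply, innerPairs_apply_fst h2 hx hz]
    abel
  · simp only [embBracket_apply, Prod.fst_add, Prod.snd_add, LinearMap.add_apply,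
      LinearMap.sub_apply, LinearMap.comp_apply, map_add, rightMul_apply,
      innerPairs_derivation h1 h2 hz, innerPairs_derivation h1 h2 hy,
      innerPairs_fst_apply h2 hx, innerPairs_left h1 hy,
      innerPairs_right h2 hy, innerPairs_right h2 hz, innerPairs_apply_fst h2 hx hz]
    abel
  · simp only [embBracket_apply, Prod.snd_add, LinearMap.add_apply,
      LinearMap.sub_apply, LinearMap.comp_apply, map_add, map_sub, rightMul_apply,
      innerPairs_derivation h1 h2 hz, innerPairs_derivation h1 h2 hy,
      innerPairs_derivation h1 h2 hx,
      innerPairs_left h1 hx, innerPairs_left h1 hy,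
      innerPairs_right h2 hx, innerPairs_right h2 hy]
    abel

end Envelope

section Realization

set_option linter.unusedSectionVars false

/-- The standard Leibniz algebra `T ⊕ innerPairs t` in which `T` is embedded. -/
abbrev StdEmbedding (t : T →ₗ[K] T →ₗ[K] T →ₗ[K] T) :=
  ↥((innerPairs t).comap (LinearMap.snd K T (Module.End K T × Module.End K T)))

/-- The Leibniz bracket of the standard embedding. -/
def stdBracket {t : T →ₗ[K] T →ₗ[K] T →ₗ[K] T} (h1 : LTS1 t) (h2 : LTS2 t) :
    StdEmbedding t →ₗ[K] StdEmbedding t →ₗ[K] StdEmbedding t :=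
  LinearMap.mk₂ K (fun x y => ⟨embBracket t x.1 y.1, embBracket_mem h1 h2 x.2 y.2⟩)
    (fun x x' y => Subtype.ext (by simp))
    (fun r x y => Subtype.ext (by simp))
    (fun x y y' => Subtype.ext (by simp))
    (fun r x y => Subtype.ext (by simp))

/-- The inclusion of `T` into its standard embedding. -/
def stdInl (t : T →ₗ[K] T →ₗ[K] T →ₗ[K] T) : T →ₗ[K] StdEmbedding t :=
  (LinearMap.inl K T (Module.End K T × Module.End K T)).codRestrict _
    (fun _ => zero_mem (innerPairs t))

/-- The grading involution of the standard embedding. -/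
def stdInvolution (t : T →ₗ[K] T →ₗ[K] T →ₗ[K] T) : StdEmbedding t →ₗ[K] StdEmbedding t where
  toFun x := ⟨(-x.1.1, x.1.2), x.2⟩
  map_add' x y := Subtype.ext (Prod.ext (by simp; abel) rfl)
  map_smul' r x := Subtype.ext (Prod.ext (by simp) rfl)

variable {t : T →ₗ[K] T →ₗ[K] T →ₗ[K] T}

lemma stdInvolution_stdInvolution (x : StdEmbedding t) :
    stdInvolution t (stdInvolution t x) = x :=
  Subtype.ext (Prod.ext (neg_neg x.1.1) rfl)

lemma stdInvolution_stdInl (a : T) : stdInvolution t (stdInl t a) = - stdInl t a :=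
  Subtype.ext (Prod.ext rfl neg_zero.symm)

lemma exists_stdInl_eq {x : StdEmbedding t} (hx : stdInvolution t x = -x) :
    ∃ a, stdInl t a = x := by
  refine ⟨x.1.1, Subtype.ext (Prod.ext rfl ?_)⟩
  have h : x.1.2 = - x.1.2 := congrArg (fun y : StdEmbedding t => y.1.2) hx
  have h' : (2 : K) • x.1.2 = 0 := by
    rw [two_smul]
    nth_rewrite 1 [h]
    exact neg_add_cancel _
  exact ((smul_eq_zero.1 h').resolve_left two_ne_zero).symm

lemma stdInvolution_stdBracket (h1 : LTS1 t) (h2 : LTS2 t) (x y : StdEmbedding t) :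
    stdInvolution t (stdBracket h1 h2 x y) =
      stdBracket h1 h2 (stdInvolution t x) (stdInvolution t y) := by
  obtain ⟨⟨a, u, v⟩, hx⟩ := x
  obtain ⟨⟨b, w, z⟩, hy⟩ := y
  refine Subtype.ext ?_
  change (-(u b + z a), t a b + z ∘ₗ u + u ∘ₗ w, rightMul t a b + z ∘ₗ v - v ∘ₗ z) =
    (u (-b) + z (-a), t (-a) (-b) + z ∘ₗ u + u ∘ₗ w, rightMul t (-a) (-b) + z ∘ₗ v - v ∘ₗ z)
  simp only [map_neg, LinearMap.neg_apply, neg_neg, neg_add]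

lemma stdBracket_stdInl_val (h1 : LTS1 t) (h2 : LTS2 t) (a b : T) :
    (stdBracket h1 h2 (stdInl t a) (stdInl t b)).1 = (0, t a b, rightMul t a b) := by
  change ((0 : Module.End K T) b + (0 : Module.End K T) a,
    t a b + (0 : Module.End K T) ∘ₗ (0 : Module.End K T) +
      (0 : Module.End K T) ∘ₗ (0 : Module.End K T),
    rightMul t a b + (0 : Module.End K T) ∘ₗ (0 : Module.End K T) -
      (0 : Module.End K T) ∘ₗ (0 : Module.End K T)) = _
  simp

lemma stdBracket_stdBracket_stdInl (h1 : LTS1 t) (h2 : LTS2 t) (a b c : T) :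
    stdBracket h1 h2 (stdBracket h1 h2 (stdInl t a) (stdInl t b)) (stdInl t c) =
      stdInl t (t a b c) := by
  refine Subtype.ext ?_
  change embBracket t (stdBracket h1 h2 (stdInl t a) (stdInl t b)).1 (c, 0, 0) = (t a b c, 0, 0)
  rw [stdBracket_stdInl_val, embBracket_apply]
  simp

lemma stdInl_injective : Function.Injective (stdInl t) := fun _ _ h =>
  congrArg (fun y : StdEmbedding t => y.1.1) h

lemma stdEmbedding_le_span (h1 : LTS1 t) (h2 : LTS2 t) (x : StdEmbedding t) :
    x ∈ LinearMap.range (stdInl t) ⊔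
      Submodule.span K {z | ∃ a b, z = stdBracket h1 h2 (stdInl t a) (stdInl t b)} := by
  have key : ∀ w (hw : w ∈ innerPairs t), (⟨(0, w), hw⟩ : StdEmbedding t) ∈
      Submodule.span K {z | ∃ a b, z = stdBracket h1 h2 (stdInl t a) (stdInl t b)} := by
    intro w hw
    induction hw using Submodule.span_induction with
    | mem w hw =>
      obtain ⟨a, b, rfl⟩ := hw
      exact Submodule.subset_span ⟨a, b, Subtype.ext (stdBracket_stdInl_val h1 h2 a b).symm⟩
    | zero => exact zero_mem _
    | add w w' hw hw' ih ih' =>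
      convert add_mem ih ih' using 1
      exact Subtype.ext (Prod.ext (add_zero 0).symm rfl)
    | smul r w hw ih =>
      convert Submodule.smul_mem _ r ih using 1
      exact Subtype.ext (Prod.ext (smul_zero r).symm rfl)
  have hx : x = stdInl t x.1.1 + ⟨(0, x.1.2), x.2⟩ :=
    Subtype.ext (Prod.ext (add_zero _).symm (zero_add _).symm)
  rw [hx]
  exact Submodule.add_mem_sup ⟨_, rfl⟩ (key _ x.2)

lemma tspan_le {A B C N : Submodule K T}
    (h : ∀ a ∈ A, ∀ b ∈ B, ∀ c ∈ C, t a b c ∈ N) : tspan t A B C ≤ N := by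
  refine Submodule.span_le.2 ?_
  rintro _ ⟨a, ha, b, hb, c, hc, rfl⟩
  exact h a ha b hb c hc

lemma derRel_succ_le {A I N : Submodule K T} {n : ℕ}
    (h1 : ∀ a ∈ A, ∀ x ∈ derRel t A I n, ∀ y ∈ derRel t A I n, t a x y ∈ N)
    (h2 : ∀ x ∈ derRel t A I n, ∀ a ∈ A, ∀ y ∈ derRel t A I n, t x a y ∈ N)
    (h3 : ∀ x ∈ derRel t A I n, ∀ y ∈ derRel t A I n, ∀ a ∈ A, t x y a ∈ N) :
    derRel t A I (n + 1) ≤ N :=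
  sup_le (sup_le (tspan_le h1) (tspan_le h2)) (tspan_le h3)

theorem exists_semisimple_realization {T : Type v} [AddCommGroup T] [Module K T]
    [FiniteDimensional K T] {t : T →ₗ[K] T →ₗ[K] T →ₗ[K] T} (h1 : LTS1 t) (h2 : LTS2 t) :
    ∃ (Q : Type v) (_ : LieRing Q) (_ : LieAlgebra K Q) (_ : LieAlgebra.HasTrivialRadical K Q)
      (_ : FiniteDimensional K Q) (φ : T →ₗ[K] Q) (S : Submodule K T),
      (∀ a b c, φ (t a b c) = ⁅⁅φ a, φ b⁆, φ c⁆) ∧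
      ((⊤ : Submodule K Q) ≤ LinearMap.range φ ⊔ Submodule.span K
        {z | ∃ a ∈ LinearMap.range φ, ∃ b ∈ LinearMap.range φ, z = ⁅a, b⁆}) ∧
      IsCompl S (LinearMap.ker φ) ∧
      (∀ a ∈ S, ∀ b ∈ S, ∀ c ∈ S, t a b c ∈ S) ∧
      IsSolvT t (LinearMap.ker φ) := by
  obtain ⟨Q, _, _, _, F, G, hFG, hF, hG, hσ, D, hD0, hDi, hDs, k, hk⟩ :=
    exists_levi_splitting_leibniz (stdBracket h1 h2)
      (fun x y z => Subtype.ext (embBracket_leibniz h1 h2 x.2 y.2 z.2))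
      stdInvolution_stdInvolution (stdInvolution_stdBracket h1 h2)
  have hsurj : Function.Surjective F := fun x => ⟨G x, hFG x⟩
  have : FiniteDimensional K Q := Module.Finite.of_surjective F hsurj
  refine ⟨Q, _, _, inferInstance, this, F ∘ₗ stdInl t, (LinearMap.range G).comap (stdInl t),
    ?_, ?_, ?_, ?_, ?_⟩
  · intro a b c
    simp only [LinearMap.comp_apply, ← stdBracket_stdBracket_stdInl h1 h2, hF]
  · rintro q -
    obtain ⟨x, rfl⟩ := hsurj q
    have hx := Submodule.mem_map_of_mem (f := F) (stdEmbedding_le_span h1 h2 x)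
    rw [Submodule.map_sup, Submodule.map_span] at hx
    refine SetLike.le_def.1 (sup_le_sup ?_ (Submodule.span_mono ?_)) hx
    · rw [LinearMap.range_comp]
    · rintro _ ⟨_, ⟨a, b, rfl⟩, rfl⟩
      exact ⟨_, ⟨a, rfl⟩, _, ⟨b, rfl⟩, hF _ _⟩
  · refine ⟨?_, ?_⟩
    · rw [Submodule.disjoint_def]
      rintro a ⟨q, hq⟩ ha
      have hq0 : q = 0 := by
        rw [← hFG q, hq]
        exact ha
      refine stdInl_injective (t := t) ?_
      rw [← hq, hq0, map_zero, map_zero]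
    · rw [codisjoint_iff_le_sup]
      rintro a -
      obtain ⟨b, hb⟩ := exists_stdInl_eq (x := G (F (stdInl t a))) (by
        rw [hσ, stdInvolution_stdInl, map_neg, map_neg])
      refine Submodule.mem_sup.2 ⟨b, ⟨_, hb.symm⟩, a - b, ?_, add_sub_cancel _ _⟩
      rw [LinearMap.mem_ker, map_sub, LinearMap.comp_apply, LinearMap.comp_apply, hb, hFG,
        sub_self]
  · rintro a ⟨x, hx⟩ b ⟨y, hy⟩ c ⟨z, hz⟩
    exact ⟨⁅⁅x, y⁆, z⁆, by rw [← hG, ← hG, hx, hy, hz, stdBracket_stdBracket_stdInl]⟩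
  · have hle : ∀ n, derT t (LinearMap.ker (F ∘ₗ stdInl t)) n ≤ (D n).comap (stdInl t) := by
      intro n
      induction n with
      | zero =>
        intro a ha
        rw [Submodule.mem_comap, hD0]
        exact ha
      | succ n ih =>
        refine derRel_succ_le ?_ ?_ ?_
        · intro a _ x hx y hy
          rw [Submodule.mem_comap, ← stdBracket_stdBracket_stdInl h1 h2]
          exact hDs n _ (hDi n _ (ih hx) _).2 _ (ih hy)
        · intro x hx a _ y hy
          rw [Submodule.mem_comap, ← stdBracket_stdBracket_stdInl h1 h2]
          exact hDs n _ (hDi n _ (ih hx) _).1 _ (ih hy)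
        · intro x hx y hy a _
          rw [Submodule.mem_comap, ← stdBracket_stdBracket_stdInl h1 h2]
          exact (hDi (n + 1) _ (hDs n _ (ih hx) _ (ih hy)) _).1
    refine ⟨k + 1, ?_⟩
    have hz : ∀ y ∈ derT t (LinearMap.ker (F ∘ₗ stdInl t)) k, ∀ x,
        stdBracket h1 h2 x (stdInl t y) = 0 := fun y hy x => hk _ (hle k hy) x
    rw [eq_bot_iff]
    refine derRel_succ_le ?_ ?_ ?_
    · intro a _ x hx y hy
      refine (Submodule.mem_bot K).2 (stdInl_injective (t := t) ?_)
      rw [← stdBracket_stdBracket_stdInl h1 h2, hz y hy, map_zero]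
    · intro x hx a _ y hy
      refine (Submodule.mem_bot K).2 (stdInl_injective (t := t) ?_)
      rw [← stdBracket_stdBracket_stdInl h1 h2, hz y hy, map_zero]
    · intro x hx y hy a _
      refine (Submodule.mem_bot K).2 (stdInl_injective (t := t) ?_)
      rw [← stdBracket_stdBracket_stdInl h1 h2, hz y hy, map_zero, LinearMap.zero_apply, map_zero]

end Realization

section Radical

set_option linter.unusedSectionVars false

variable {t : T →ₗ[K] T →ₗ[K] T →ₗ[K] T}

/-- A relatively solvable relative ideal lies in the kernel of a semisimple realization. -/
lemma le_ker_of_derRel_eq_bot {Q : Type*} [LieRing Q] [LieAlgebra K Q]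
    [LieAlgebra.HasTrivialRadical K Q] [FiniteDimensional K Q] {φ : T →ₗ[K] Q}
    (hφ : ∀ a b c, φ (t a b c) = ⁅⁅φ a, φ b⁆, φ c⁆)
    (hP : (⊤ : Submodule K Q) ≤ LinearMap.range φ ⊔ Submodule.span K
      {z | ∃ a ∈ LinearMap.range φ, ∃ b ∈ LinearMap.range φ, z = ⁅a, b⁆})
    {C I : Submodule K T} (hC : ∀ a, ∃ c ∈ C, φ c = φ a)
    (hI : ∀ x ∈ I, ∀ a ∈ C, ∀ b ∈ C, t x a b ∈ I ∧ t a x b ∈ I ∧ t a b x ∈ I)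
    {k : ℕ} (hk : derRel t C I k = ⊥) : I ≤ LinearMap.ker φ := by
  have hPP : IsTripleIdeal (LinearMap.range φ) (LinearMap.range φ) := by
    refine ⟨le_rfl, ?_⟩
    rintro _ ⟨x, rfl⟩ _ ⟨a, rfl⟩ _ ⟨b, rfl⟩
    exact ⟨⟨_, hφ x a b⟩, ⟨_, hφ a b x⟩⟩
  have hY : IsTripleIdeal (LinearMap.range φ) (I.map φ) := by
    refine ⟨LinearMap.map_le_range, ?_⟩
    rintro _ ⟨x, hx, rfl⟩ _ ⟨a, rfl⟩ _ ⟨b, rfl⟩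
    obtain ⟨a', ha', h⟩ := hC a
    obtain ⟨b', hb', h'⟩ := hC b
    rw [← h, ← h', ← hφ, ← hφ]
    exact ⟨⟨_, (hI x hx a' ha' b' hb').1, rfl⟩, ⟨_, (hI x hx a' ha' b' hb').2.2, rfl⟩⟩
  have hle : ∀ n, (tripleDerived (LinearMap.range φ))^[n] (I.map φ) ≤
      (derRel t C I n).map φ := by
    intro n
    induction n with
    | zero => exact le_rfl
    | succ n ih =>
      rw [Function.iterate_succ_apply']
      refine Submodule.span_le.2 ?_
      rintro _ ⟨x, hx, _, ⟨p, rfl⟩, y, hy, rfl⟩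
      obtain ⟨x, hx', rfl⟩ := ih hx
      obtain ⟨y, hy', rfl⟩ := ih hy
      obtain ⟨c, hc, h⟩ := hC p
      rw [← h, ← hφ]
      exact Submodule.mem_map_of_mem (Submodule.mem_sup_left (Submodule.mem_sup_right
        (Submodule.subset_span ⟨x, hx', c, hc, y, hy', rfl⟩)))
  have hk0 : (tripleDerived (LinearMap.range φ))^[k] (I.map φ) = ⊥ := by
    rw [eq_bot_iff]
    refine (hle k).trans ?_
    rw [hk, Submodule.map_bot]
  exact LinearMap.le_ker_iff_map.2
    (IsTripleIdeal.eq_bot_of_iterate_tripleDerived_eq_bot hP hPP hY hk0)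

lemma radT_eq_ker {Q : Type*} [LieRing Q] [LieAlgebra K Q]
    [LieAlgebra.HasTrivialRadical K Q] [FiniteDimensional K Q] {φ : T →ₗ[K] Q}
    (hφ : ∀ a b c, φ (t a b c) = ⁅⁅φ a, φ b⁆, φ c⁆)
    (hP : (⊤ : Submodule K Q) ≤ LinearMap.range φ ⊔ Submodule.span K
      {z | ∃ a ∈ LinearMap.range φ, ∃ b ∈ LinearMap.range φ, z = ⁅a, b⁆})
    (hs : IsSolvT t (LinearMap.ker φ)) : radT t = LinearMap.ker φ := by
  refine le_antisymm (sSup_le ?_) (le_sSup ⟨?_, hs⟩)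
  · rintro I ⟨hI, k, hk⟩
    exact le_ker_of_derRel_eq_bot hφ hP (fun a => ⟨a, Submodule.mem_top, rfl⟩)
      (fun x hx a _ b _ => hI x hx a b) hk
  · intro x hx a b
    have hx0 : φ x = 0 := hx
    simp [LinearMap.mem_ker, hφ, hx0]

end Radical

/-- Levi's theorem for Leibniz triple systems: there is a subsystem `S` with
`T = S ⊕ R(T)` as vector spaces, and `S` is a semisimple Lie triple system
(with the restricted ternary product). -/
theorem levi_theorem_for_LeibTS
    [FiniteDimensional K T]
    (t : T →ₗ[K] T →ₗ[K] T →ₗ[K] T) (h1 : LTS1 t) (h2 : LTS2 t) :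
    ∃ S : Submodule K T,
      (∀ a ∈ S, ∀ b ∈ S, ∀ c ∈ S, t a b c ∈ S) ∧
      IsCompl S (radT t) ∧
      (∀ a ∈ S, ∀ c ∈ S, t a a c = 0) ∧
      (∀ a ∈ S, ∀ b ∈ S, ∀ c ∈ S, t a b c + t b c a + t c a b = 0) ∧
      (∀ a ∈ S, ∀ b ∈ S, ∀ c ∈ S, ∀ d ∈ S, ∀ e ∈ S,
        t a b (t c d e) = t (t a b c) d e + t c (t a b d) e + t c d (t a b e)) ∧
      (∀ S' : Submodule K T, S' ≤ S →
        (∀ x ∈ S', ∀ a ∈ S, ∀ b ∈ S,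
          t x a b ∈ S' ∧ t a x b ∈ S' ∧ t a b x ∈ S') →
        (∃ k, derRel t S S' k = ⊥) → S' = ⊥) := by
  obtain ⟨Q, _, _, _, _, φ, S, hφ, hP, hS, hSt, hsol⟩ := exists_semisimple_realization h1 h2
  have hinj : ∀ a ∈ S, φ a = 0 → a = 0 := fun a ha h =>
    Submodule.disjoint_def.1 hS.disjoint a ha h
  refine ⟨S, hSt, ?_, ?_, ?_, ?_, ?_⟩
  · rw [radT_eq_ker hφ hP hsol]
    exact hS
  · intro a ha c hc
    refine hinj _ (hSt a ha a ha c hc) ?_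
    rw [hφ, lie_self, zero_lie]
  · intro a ha b hb c hc
    refine hinj _ (add_mem (add_mem (hSt a ha b hb c hc) (hSt b hb c hc a ha))
      (hSt c hc a ha b hb)) ?_
    rw [map_add, map_add, hφ, hφ, hφ, ← lie_skew, ← lie_skew ⁅φ b, φ c⁆, ← lie_skew ⁅φ c, φ a⁆,
      ← neg_add, ← neg_add, neg_eq_zero, ← lie_jacobi (φ a) (φ b) (φ c)]
    abel
  · intro a ha b hb c hc d hd e he
    refine sub_eq_zero.1 (hinj _ (sub_mem (hSt a ha b hb _ (hSt c hc d hd e he))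
      (add_mem (add_mem (hSt _ (hSt a ha b hb c hc) d hd e he)
        (hSt c hc _ (hSt a ha b hb d hd) e he)) (hSt c hc d hd _ (hSt a ha b hb e he)))) ?_)
    rw [map_sub, sub_eq_zero]
    simp only [map_add, hφ]
    rw [leibniz_lie ⁅φ a, φ b⁆ ⁅φ c, φ d⁆ (φ e), leibniz_lie ⁅φ a, φ b⁆ (φ c) (φ d), add_lie]
  · rintro S' hS' hid ⟨k, hk⟩
    have hker : S' ≤ LinearMap.ker φ := by
      refine le_ker_of_derRel_eq_bot hφ hP (fun a => ?_) hid hk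
      obtain ⟨c, hc, r, hr, rfl⟩ := Submodule.mem_sup.1
        (hS.codisjoint.top_le (Submodule.mem_top (x := a)))
      have hr0 : φ r = 0 := hr
      exact ⟨c, hc, by rw [map_add, hr0, add_zero]⟩
    rw [eq_bot_iff]
    exact hS.disjoint hS' hker

end
end
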